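/- arXiv:1409.7537 — 4 statements merged into one kernel-verified Lean document; each statement's English description precedes it below -/
import Mathlib

section
/- The infimum of the Möbius cross energy E(γ₁,γ₂) over all 2-component links in ℝ³ (C¹ maps γ₁, γ₂ : ℝ → ℝ³, 2π-periodic, with disjoint images) satisfying |lk(γ₁,γ₂)| = 1 equals 2π², and this infimum is attained. -/
open Real MeasureTheory

noncomputable section

/-- The Möbius cross energy of a pair of `2π`-periodic curves. -/
def mobiusEnergy {E : Type*} [NormedAddCommGroup E] [NormedSpace ℝ E] (γ₁ γ₂ : ℝ → E) : ℝ :=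
  ∫ s in (0 : ℝ)..(2 * π), ∫ t in (0 : ℝ)..(2 * π),
    ‖deriv γ₁ s‖ * ‖deriv γ₂ t‖ / ‖γ₁ s - γ₂ t‖ ^ 2

/-- The determinant of three column vectors in `ℝ³`. -/
def det3 (a b c : EuclideanSpace ℝ (Fin 3)) : ℝ :=
  Matrix.det !![a 0, b 0, c 0; a 1, b 1, c 1; a 2, b 2, c 2]

/-- The Gauss linking integral of a pair of `2π`-periodic curves in `ℝ³`. -/
def gaussLinking (γ₁ γ₂ : ℝ → EuclideanSpace ℝ (Fin 3)) : ℝ :=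
  (1 / (4 * π)) * ∫ s in (0 : ℝ)..(2 * π), ∫ t in (0 : ℝ)..(2 * π),
    det3 (deriv γ₁ s) (deriv γ₂ t) (γ₁ s - γ₂ t) / ‖γ₁ s - γ₂ t‖ ^ 3

/-- Translating a continuous `1`-periodic function multiplies its Fourier coefficients by a
character. -/
lemma fourierCoeffOn_shift_sub (f : ℝ → ℂ) (hf : Continuous f) (hp : Function.Periodic f 1)
    (h : ℝ) (n : ℤ) :
    fourierCoeffOn zero_lt_one (fun x => f (x + h) - f x) n
      = (Complex.exp (2 * π * Complex.I * n * h) - 1) * fourierCoeffOn zero_lt_one f n := by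
  have key : ∀ x : ℝ, fourier (-n) (x : AddCircle ((1 : ℝ) - 0))
      = Complex.exp (-(2 * π * Complex.I * n * x)) := by
    intro x
    rw [fourier_coe_apply]
    congr 1
    push_cast
    ring
  simp only [fourierCoeffOn_eq_integral, key, smul_eq_mul]
  have hc : Continuous fun x : ℝ => Complex.exp (-(2 * π * Complex.I * n * x)) := by fun_prop
  have h1 : ∫ x in (0 : ℝ)..1, Complex.exp (-(2 * π * Complex.I * n * x)) * (f (x + h) - f x)
      = (∫ x in (0 : ℝ)..1, Complex.exp (-(2 * π * Complex.I * n * x)) * f (x + h))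
        - ∫ x in (0 : ℝ)..1, Complex.exp (-(2 * π * Complex.I * n * x)) * f x := by
    rw [← intervalIntegral.integral_sub]
    · simp only [mul_sub]
    · exact Continuous.intervalIntegrable (by fun_prop) _ _
    · exact Continuous.intervalIntegrable (by fun_prop) _ _
  have h2 : ∫ x in (0 : ℝ)..1, Complex.exp (-(2 * π * Complex.I * n * x)) * f (x + h)
      = Complex.exp (2 * π * Complex.I * n * h)
        * ∫ x in (0 : ℝ)..1, Complex.exp (-(2 * π * Complex.I * n * x)) * f x := by
    let g : ℝ → ℂ := fun x => Complex.exp (-(2 * π * Complex.I * n * x)) * f x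
    have hg : Function.Periodic g 1 := by
      intro x
      simp only [g, hp x]
      congr 1
      rw [Complex.exp_eq_exp_iff_exists_int]
      exact ⟨-n, by push_cast; ring⟩
    have h3 : ∫ x in (0 : ℝ)..1, g (x + h) = ∫ x in (0 : ℝ)..1, g x := by
      rw [intervalIntegral.integral_comp_add_right]
      have := hg.intervalIntegral_add_eq h 0
      rw [zero_add] at this ⊢
      rw [add_comm 1 h, this]
    change _ = _ * ∫ x in (0 : ℝ)..1, g x
    rw [← h3, ← intervalIntegral.integral_const_mul]
    congr 1
    ext x
    simp only [g]
    rw [← mul_assoc, ← Complex.exp_add]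
    congr 2
    push_cast
    ring
  simp only [sub_zero, div_one, one_smul]
  rw [h1, h2]
  ring

/-- Parseval's identity for continuous real functions on `[0,1]`. -/
lemma hasSum_sq_fourierCoeffOn_ofReal (f : ℝ → ℝ) (hf : Continuous f) :
    HasSum (fun n => ‖fourierCoeffOn zero_lt_one (fun x => (f x : ℂ)) n‖ ^ 2)
      (∫ x in (0 : ℝ)..1, f x ^ 2) := by
  have hL : MemLp (fun x => (f x : ℂ)) 2 (volume.restrict (Set.Ioc 0 1)) := by
    have hc : Continuous fun x => (f x : ℂ) := by fun_prop
    obtain ⟨C, hC⟩ := (isCompact_Icc (a := (0 : ℝ)) (b := 1)).exists_bound_of_continuousOn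
      hc.continuousOn
    refine MemLp.of_bound hc.aestronglyMeasurable C ?_
    exact (ae_restrict_iff' measurableSet_Ioc).mpr
      (Filter.Eventually.of_forall fun x hx => hC x (Set.Ioc_subset_Icc_self hx))
  have := hasSum_sq_fourierCoeffOn zero_lt_one hL
  simpa using this

/-- **Wirtinger's inequality** for a closed Lipschitz curve, in coordinates. -/
lemma wirtinger_of_lipschitz {ι : Type*} [Fintype ι] (Z : ι → ℝ → ℝ) (Λ : ℝ)
    (hper : ∀ i, Function.Periodic (Z i) 1)
    (hlip : ∀ x y, ∑ i, (Z i x - Z i y) ^ 2 ≤ Λ ^ 2 * (x - y) ^ 2) :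
    ∑ i, ((∫ x in (0 : ℝ)..1, Z i x ^ 2) - (∫ x in (0 : ℝ)..1, Z i x) ^ 2)
      ≤ Λ ^ 2 / (4 * π ^ 2) := by
  have hcont : ∀ i, Continuous (Z i) := by
    intro i
    have : LipschitzWith (Real.toNNReal |Λ|) (Z i) := by
      refine LipschitzWith.of_dist_le_mul fun x y => ?_
      rw [Real.coe_toNNReal _ (abs_nonneg _), Real.dist_eq, Real.dist_eq, ← abs_mul]
      refine sq_le_sq.mp ?_
      rw [mul_pow]
      exact (Finset.single_le_sum (f := fun i => (Z i x - Z i y) ^ 2)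
        (fun j _ => sq_nonneg _) (Finset.mem_univ i)).trans (hlip x y)
    exact this.continuous
  set c : ι → ℤ → ℂ := fun i n => fourierCoeffOn zero_lt_one (fun x => (Z i x : ℂ)) n with hc
  set e : ℤ → ℝ → ℂ := fun n h => Complex.exp (2 * π * Complex.I * n * h) - 1 with he
  have hshift : ∀ (S : Finset ℤ) (h : ℝ),
      ∑ n ∈ S, ‖e n h‖ ^ 2 * ∑ i, ‖c i n‖ ^ 2 ≤ Λ ^ 2 * h ^ 2 := by
    intro S h
    have h1 : ∀ i, ∑ n ∈ S, ‖e n h‖ ^ 2 * ‖c i n‖ ^ 2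
        ≤ ∫ x in (0 : ℝ)..1, (Z i (x + h) - Z i x) ^ 2 := by
      intro i
      have hs := hasSum_sq_fourierCoeffOn_ofReal (fun x => Z i (x + h) - Z i x)
        (((hcont i).comp (continuous_id.add continuous_const)).sub (hcont i))
      have := sum_le_hasSum S (fun n _ => by positivity) hs
      refine le_trans (le_of_eq ?_) this
      refine Finset.sum_congr rfl fun n _ => ?_
      have h2 := fourierCoeffOn_shift_sub (fun x => (Z i x : ℂ))
        (Complex.continuous_ofReal.comp (hcont i)) (fun x => by simp [hper i x]) h n
      push_cast
      rw [h2, norm_mul, mul_pow]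
    calc ∑ n ∈ S, ‖e n h‖ ^ 2 * ∑ i, ‖c i n‖ ^ 2
        = ∑ i, ∑ n ∈ S, ‖e n h‖ ^ 2 * ‖c i n‖ ^ 2 := by
          simp only [Finset.mul_sum]
          exact Finset.sum_comm
      _ ≤ ∑ i, ∫ x in (0 : ℝ)..1, (Z i (x + h) - Z i x) ^ 2 :=
          Finset.sum_le_sum fun i _ => h1 i
      _ = ∫ x in (0 : ℝ)..1, ∑ i, (Z i (x + h) - Z i x) ^ 2 := by
          rw [intervalIntegral.integral_finsetSum]
          intro i _
          have := hcont i
          exact Continuous.intervalIntegrable (by fun_prop) _ _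
      _ ≤ ∫ x in (0 : ℝ)..1, Λ ^ 2 * h ^ 2 := by
          refine intervalIntegral.integral_mono_on zero_le_one ?_ ?_ ?_
          · exact Continuous.intervalIntegrable (by fun_prop) _ _
          · exact Continuous.intervalIntegrable (by fun_prop) _ _
          · intro x _
            have := hlip (x + h) x
            rwa [add_sub_cancel_left] at this
      _ = Λ ^ 2 * h ^ 2 := by simp
  have hlim : ∀ n : ℤ, Filter.Tendsto (fun h : ℝ => (‖e n h‖ / ‖h‖) ^ 2) (nhdsWithin 0 {0}ᶜ)
      (nhds ((2 * π * n) ^ 2)) := by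
    intro n
    have hd : HasDerivAt (e n) (2 * π * Complex.I * n) 0 := by
      have h1 : HasDerivAt (fun h : ℝ => 2 * π * Complex.I * n * (h : ℂ))
          (2 * π * Complex.I * n) 0 := by
        simpa using (Complex.ofRealCLM.hasDerivAt (x := (0 : ℝ))).const_mul
          (2 * π * Complex.I * n)
      have h2 := h1.cexp.sub_const 1
      simpa [he] using h2
    have h3 := (hasDerivAt_iff_tendsto_slope.mp hd).norm.pow 2
    refine (h3.congr fun h => ?_).trans (le_of_eq ?_)
    · simp only [slope, vsub_eq_sub, sub_zero, norm_smul, norm_inv]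
      have : e n 0 = 0 := by simp [he]
      rw [this, sub_zero, div_eq_inv_mul]
    · congr 1
      simp [abs_of_pos pi_pos, mul_pow]
  have hfin : ∀ S : Finset ℤ, ∑ n ∈ S, (2 * π * n) ^ 2 * ∑ i, ‖c i n‖ ^ 2 ≤ Λ ^ 2 := by
    intro S
    have ht : Filter.Tendsto (fun h : ℝ => ∑ n ∈ S, (‖e n h‖ / ‖h‖) ^ 2 * ∑ i, ‖c i n‖ ^ 2)
        (nhdsWithin 0 {0}ᶜ) (nhds (∑ n ∈ S, (2 * π * n) ^ 2 * ∑ i, ‖c i n‖ ^ 2)) :=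
      tendsto_finsetSum _ fun n _ => (hlim n).mul_const _
    refine le_of_tendsto ht ?_
    filter_upwards [self_mem_nhdsWithin] with h hh
    have hpos : 0 < h ^ 2 := by
      have : h ≠ 0 := hh
      positivity
    have := hshift S h
    rw [← div_le_iff₀ hpos, Finset.sum_div] at this
    refine le_trans (le_of_eq ?_) this
    refine Finset.sum_congr rfl fun n _ => ?_
    rw [div_pow, Real.norm_eq_abs h, sq_abs]
    ring
  have hsum : HasSum (fun n => ∑ i, ‖c i n‖ ^ 2) (∑ i, ∫ x in (0 : ℝ)..1, Z i x ^ 2) :=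
    hasSum_sum fun i _ => hasSum_sq_fourierCoeffOn_ofReal (Z i) (hcont i)
  have hzero : ∑ i, ‖c i 0‖ ^ 2 = ∑ i, (∫ x in (0 : ℝ)..1, Z i x) ^ 2 := by
    refine Finset.sum_congr rfl fun i _ => ?_
    simp [hc, fourierCoeffOn_eq_integral]
    rw [intervalIntegral.integral_ofReal]
    simp
  rw [Finset.sum_sub_distrib, ← hzero, sub_le_iff_le_add]
  refine hasSum_le_of_sum_le hsum fun S => ?_
  have h4 : ∀ n ∈ S, ∑ i, ‖c i n‖ ^ 2
      ≤ (2 * π * n) ^ 2 * (∑ i, ‖c i n‖ ^ 2) / (4 * π ^ 2)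
        + if n = 0 then ∑ i, ‖c i 0‖ ^ 2 else 0 := by
    intro n _
    have hnn : 0 ≤ ∑ i, ‖c i n‖ ^ 2 := by positivity
    by_cases hn : n = 0
    · simp [hn]
    · have h1 : (1 : ℝ) ≤ (n : ℝ) ^ 2 := by
        have : (1 : ℤ) ≤ n ^ 2 := by
          have : 0 < n ^ 2 := by positivity
          omega
        exact_mod_cast this
      rw [if_neg hn, add_zero, le_div_iff₀ (by positivity)]
      have : (2 * π * n) ^ 2 * (∑ i, ‖c i n‖ ^ 2)
          = (∑ i, ‖c i n‖ ^ 2) * (4 * π ^ 2) * (n : ℝ) ^ 2 := by ring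
      rw [this]
      exact le_mul_of_one_le_right (by positivity) h1
  refine (Finset.sum_le_sum h4).trans ?_
  rw [Finset.sum_add_distrib, ← Finset.sum_div]
  refine add_le_add ?_ ?_
  · exact div_le_div_of_nonneg_right (hfin S) (by positivity)
  · rw [Finset.sum_ite_eq']
    split_ifs
    · exact le_rfl
    · positivity

/-- The weighted form of Wirtinger's inequality: the curve `z` has speed at most `g`. -/
lemma wirtinger_weighted {ι : Type*} [Fintype ι] (z : ι → ℝ → ℝ) (g : ℝ → ℝ) {P : ℝ}
    (hg : Continuous g) (hgP : Function.Periodic g P)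
    (hJ : 0 < ∫ s in (0 : ℝ)..P, g s) (hz : ∀ i, Function.Periodic (z i) P)
    (hlip : ∀ a b, ∑ i, (z i b - z i a) ^ 2 ≤ (∫ s in a..b, g s) ^ 2) :
    (∫ s in (0 : ℝ)..P, g s) * ∑ i, (∫ s in (0 : ℝ)..P, z i s ^ 2 * g s)
      - ∑ i, (∫ s in (0 : ℝ)..P, z i s * g s) ^ 2
      ≤ (∫ s in (0 : ℝ)..P, g s) ^ 4 / (4 * π ^ 2) := by
  set J := ∫ s in (0 : ℝ)..P, g s with hJdef
  have hgi : ∀ a b, IntervalIntegrable g volume a b := fun a b => hg.intervalIntegrable a b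
  set θ : ℝ → ℝ := fun s => (∫ x in (0 : ℝ)..s, g x) / J with hθ
  have hθd : ∀ s, HasDerivAt θ (g s / J) s := fun s =>
    (intervalIntegral.integral_hasDerivAt_right (hgi 0 s)
      (hg.stronglyMeasurableAtFilter _ _) hg.continuousAt).div_const J
  have hθc : Continuous θ := continuous_iff_continuousAt.mpr fun s => (hθd s).continuousAt
  have hθsub : ∀ a b, J * (θ b - θ a) = ∫ s in a..b, g s := by
    intro a b
    have := intervalIntegral.integral_add_adjacent_intervals (hgi 0 a) (hgi a b)
    simp only [hθ]
    field_simp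
    linarith
  have hθP : ∀ s, θ (s + P) = θ s + 1 := by
    intro s
    have h1 := hθsub s (s + P)
    have h2 := hgP.intervalIntegral_add_eq s 0
    rw [zero_add] at h2
    rw [h2, ← hJdef] at h1
    have := mul_left_cancel₀ hJ.ne' (h1.trans (mul_one J).symm)
    linarith
  have hθ0 : θ 0 = 0 := by simp [hθ]
  have hθn : ∀ (n : ℕ) s, θ (s + n * P) = θ s + n := by
    intro n
    induction n with
    | zero => simp
    | succ k ih =>
      intro s
      have : s + (k + 1 : ℕ) * P = (s + k * P) + P := by push_cast; ring
      rw [this, hθP, ih]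
      push_cast; ring
  have hsurj : Function.Surjective θ := by
    intro y
    obtain ⟨n, hn⟩ := exists_nat_ge |y|
    have h1 : θ (n * P) = n := by simpa [hθ0] using hθn n 0
    have h2 : θ (-(n * P)) = -n := by
      have := hθn n (-(n * P))
      rw [neg_add_cancel, hθ0] at this
      linarith
    have := isPreconnected_univ.intermediate_value (Set.mem_univ (-(n * P))) (Set.mem_univ (n * P))
      hθc.continuousOn
    rw [h1, h2] at this
    obtain ⟨x, -, hx⟩ := this (show y ∈ Set.Icc (-(n : ℝ)) n from
      ⟨by linarith [neg_abs_le y], by linarith [le_abs_self y]⟩)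
    exact ⟨x, hx⟩
  set r := Function.surjInv hsurj with hr
  have hrθ : ∀ x, θ (r x) = x := Function.surjInv_eq hsurj
  have hlip' : ∀ a b, ∑ i, (z i b - z i a) ^ 2 ≤ J ^ 2 * (θ b - θ a) ^ 2 := by
    intro a b
    rw [← mul_pow, hθsub]
    exact hlip a b
  have heq : ∀ a b, θ a = θ b → ∀ i, z i a = z i b := by
    intro a b hab i
    have h1 := hlip' b a
    rw [hab, sub_self] at h1
    have h2 := Finset.single_le_sum (f := fun i => (z i a - z i b) ^ 2)
      (fun j _ => sq_nonneg _) (Finset.mem_univ i)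
    have h3 : (z i a - z i b) ^ 2 ≤ 0 := by
      refine h2.trans (h1.trans ?_)
      simp
    nlinarith [pow_eq_zero_iff (two_ne_zero) |>.mp (le_antisymm h3 (sq_nonneg _))]
  set Z : ι → ℝ → ℝ := fun i x => z i (r x) with hZ
  have hZθ : ∀ i s, Z i (θ s) = z i s := fun i s => heq _ _ (hrθ _) i
  have hZper : ∀ i, Function.Periodic (Z i) 1 := by
    intro i x
    have h1 := hZθ i (r x + P)
    rw [hθP, hrθ] at h1
    rw [h1, hz i]
  have hZlip : ∀ x y, ∑ i, (Z i x - Z i y) ^ 2 ≤ J ^ 2 * (x - y) ^ 2 := by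
    intro x y
    have := hlip' (r y) (r x)
    rwa [hrθ, hrθ] at this
  have hZcont : ∀ i, Continuous (Z i) := by
    intro i
    have : LipschitzWith (Real.toNNReal |J|) (Z i) := by
      refine LipschitzWith.of_dist_le_mul fun x y => ?_
      rw [Real.coe_toNNReal _ (abs_nonneg _), Real.dist_eq, Real.dist_eq, ← abs_mul]
      refine sq_le_sq.mp ?_
      rw [mul_pow]
      exact (Finset.single_le_sum (f := fun i => (Z i x - Z i y) ^ 2)
        (fun j _ => sq_nonneg _) (Finset.mem_univ i)).trans (hZlip x y)
    exact this.continuous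
  have hsubst : ∀ G : ℝ → ℝ, Continuous G →
      ∫ s in (0 : ℝ)..P, G (θ s) * g s = J * ∫ x in (0 : ℝ)..1, G x := by
    intro G hG
    have h1 := intervalIntegral.integral_comp_mul_deriv (a := 0) (b := P) (f := θ)
      (f' := fun s => g s / J) (g := G) (fun s _ => hθd s) (by fun_prop) hG
    have h2 : θ P = 1 := by simpa [hθ0] using hθP 0
    rw [hθ0, h2] at h1
    rw [← h1, ← intervalIntegral.integral_const_mul]
    congr 1
    ext s
    simp only [Function.comp]
    field_simp
  have hI1 : ∀ i, ∫ s in (0 : ℝ)..P, z i s * g s = J * ∫ x in (0 : ℝ)..1, Z i x := by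
    intro i
    rw [← hsubst _ (hZcont i)]
    simp only [hZθ]
  have hI2 : ∀ i, ∫ s in (0 : ℝ)..P, z i s ^ 2 * g s = J * ∫ x in (0 : ℝ)..1, Z i x ^ 2 := by
    intro i
    rw [← hsubst (fun x => Z i x ^ 2) ((hZcont i).pow 2)]
    simp only [hZθ]
  have hW := wirtinger_of_lipschitz Z J hZper hZlip
  simp only [hI1, hI2, ← Finset.mul_sum, mul_pow]
  rw [Finset.sum_sub_distrib] at hW
  have := mul_le_mul_of_nonneg_left hW (sq_nonneg J)
  calc _ = J ^ 2 * ((∑ i, ∫ x in (0 : ℝ)..1, Z i x ^ 2) - ∑ i, (∫ x in (0 : ℝ)..1, Z i x) ^ 2) := by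
        ring
    _ ≤ _ := this
    _ = _ := by ring

/-- A curve is no longer than the integral of its speed, in coordinates. -/
lemma sum_sq_sub_le_of_hasDerivAt {ι : Type*} [Fintype ι] (z z' : ι → ℝ → ℝ) (g : ℝ → ℝ)
    (hg : Continuous g) (hg0 : ∀ s, 0 ≤ g s) (hz : ∀ i s, HasDerivAt (z i) (z' i s) s)
    (hz' : ∀ i, Continuous (z' i)) (hn : ∀ s, ∑ i, z' i s ^ 2 ≤ g s ^ 2) (a b : ℝ) :
    ∑ i, (z i b - z i a) ^ 2 ≤ (∫ s in a..b, g s) ^ 2 := by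
  wlog hab : a ≤ b generalizing a b
  · have := this b a (le_of_not_ge hab)
    rw [intervalIntegral.integral_symm, neg_sq]
    simpa only [← neg_sub (z _ a) (z _ b), neg_sq] using this
  set S := ∑ i, (z i b - z i a) ^ 2 with hS
  have hS0 : 0 ≤ S := by positivity
  have h1 : S = ∫ s in a..b, ∑ i, (z i b - z i a) * z' i s := by
    rw [intervalIntegral.integral_finsetSum
      (fun i _ => ((hz' i).const_mul _).intervalIntegrable _ _)]
    refine Finset.sum_congr rfl fun i _ => ?_
    rw [intervalIntegral.integral_const_mul, intervalIntegral.integral_eq_sub_of_hasDerivAt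
      (fun s _ => hz i s) ((hz' i).intervalIntegrable _ _), sq]
  have h2 : S ≤ ∫ s in a..b, √S * g s := by
    conv_lhs => rw [h1]
    refine intervalIntegral.integral_mono_on hab ?_ ?_ fun s _ => ?_
    · exact Continuous.intervalIntegrable (by fun_prop) _ _
    · exact Continuous.intervalIntegrable (by fun_prop) _ _
    · refine abs_le_of_sq_le_sq' ?_ (by positivity [hg0 s]) |>.2
      rw [mul_pow, sq_sqrt hS0]
      exact (Finset.sum_mul_sq_le_sq_mul_sq _ _ _).trans
        (mul_le_mul_of_nonneg_left (hn s) hS0)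
  rw [intervalIntegral.integral_const_mul] at h2
  have hI : 0 ≤ ∫ s in a..b, g s := intervalIntegral.integral_nonneg hab fun s _ => hg0 s
  rcases hS0.eq_or_lt with h | h
  · rw [← h]; positivity
  · have h3 : 0 < √S := sqrt_pos.mpr h
    have h4 : √S ≤ ∫ s in a..b, g s := by
      refine le_of_mul_le_mul_left ?_ h3
      rwa [mul_self_sqrt hS0]
    calc S = √S ^ 2 := (sq_sqrt hS0).symm
      _ ≤ _ := by gcongr

lemma Function.Periodic.deriv {E : Type*} [NormedAddCommGroup E] [NormedSpace ℝ E] {f : ℝ → E}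
    {P : ℝ} (hP : Function.Periodic f P) : Function.Periodic (deriv f) P := by
  intro s
  rw [← deriv_comp_add_const]
  congr 1
  ext1 x
  exact hP x

section ConformalWeights

variable {ι : Type*} [Fintype ι]

/-- The conformal factor `1 / (1 + l² ‖γ s - γ u‖²)` along a curve, centred at its point `γ u`. -/
def confWeight (γ : ℝ → EuclideanSpace ℝ ι) (l u s : ℝ) : ℝ :=
  1 / (1 + l ^ 2 * ‖γ s - γ u‖ ^ 2)

/-- The conformally weighted length of a `2π`-periodic curve. -/
def confLength (γ : ℝ → EuclideanSpace ℝ ι) (l u : ℝ) : ℝ :=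
  ∫ s in (0 : ℝ)..(2 * π), confWeight γ l u s * ‖deriv γ s‖

/-- The integral of the squared conformal weight along a `2π`-periodic curve. -/
def confSqLength (γ : ℝ → EuclideanSpace ℝ ι) (l u : ℝ) : ℝ :=
  ∫ s in (0 : ℝ)..(2 * π), confWeight γ l u s ^ 2 * ‖deriv γ s‖

/-- The concentration `∫ ρ²` of the probability density `ρ` proportional to the conformal weight. -/
def confConc (γ : ℝ → EuclideanSpace ℝ ι) (l u : ℝ) : ℝ :=
  confSqLength γ l u / confLength γ l u ^ 2

/-- The barycentre of a curve with respect to the squared conformal weight. -/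
def confCenter (γ : ℝ → EuclideanSpace ℝ ι) (l u : ℝ) : EuclideanSpace ℝ ι :=
  WithLp.toLp 2 fun i =>
    (∫ s in (0 : ℝ)..(2 * π), confWeight γ l u s ^ 2 * ‖deriv γ s‖ * γ s i) / confSqLength γ l u

variable {γ : ℝ → EuclideanSpace ℝ ι}

lemma confWeight_pos (γ : ℝ → EuclideanSpace ℝ ι) (l u s : ℝ) : 0 < confWeight γ l u s := by
  unfold confWeight; positivity

lemma confWeight_le_one (γ : ℝ → EuclideanSpace ℝ ι) (l u s : ℝ) : confWeight γ l u s ≤ 1 := by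
  unfold confWeight
  rw [div_le_one (by positivity)]
  nlinarith [sq_nonneg (l * ‖γ s - γ u‖)]

lemma confWeight_mul (γ : ℝ → EuclideanSpace ℝ ι) (l u s : ℝ) :
    confWeight γ l u s * (1 + l ^ 2 * ‖γ s - γ u‖ ^ 2) = 1 := by
  unfold confWeight
  have : 0 < 1 + l ^ 2 * ‖γ s - γ u‖ ^ 2 := by positivity
  field_simp

lemma continuous_confWeight (hγ : Continuous γ) :
    Continuous fun p : ℝ × ℝ × ℝ => confWeight γ p.1 p.2.1 p.2.2 := by
  unfold confWeight
  refine continuous_const.div (by fun_prop) fun p => ?_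
  positivity

@[fun_prop]
lemma Continuous.confWeight {X : Type*} [TopologicalSpace X] (hγ : Continuous γ)
    {l u s : X → ℝ} (hl : Continuous l) (hu : Continuous u) (hs : Continuous s) :
    Continuous fun x => confWeight γ (l x) (u x) (s x) :=
  (continuous_confWeight hγ).comp (hl.prodMk (hu.prodMk hs))

lemma integral_speed_pos (hγ : ContDiff ℝ 1 γ) {c : ℝ} (hc : deriv γ c ≠ 0)
    (hP : Function.Periodic γ (2 * π)) {f : ℝ → ℝ} (hf : Continuous f) (hf0 : ∀ s, 0 < f s) :
    0 < ∫ s in (0 : ℝ)..(2 * π), f s * ‖deriv γ s‖ := by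
  have hv : Continuous fun s => ‖deriv γ s‖ := (hγ.continuous_deriv le_rfl).norm
  have hdP := hP.deriv
  obtain ⟨y, hy, hcy⟩ := hdP.exists_mem_Ico₀ (by positivity) c
  refine intervalIntegral.integral_pos (by positivity) (by fun_prop)
    (fun s _ => mul_nonneg (hf0 s).le (norm_nonneg _)) ⟨y, Set.Ico_subset_Icc_self hy, ?_⟩
  exact mul_pos (hf0 y) (norm_pos_iff.mpr (hcy ▸ hc))

lemma confLength_pos (hγ : ContDiff ℝ 1 γ) (hP : Function.Periodic γ (2 * π)) {c : ℝ}
    (hc : deriv γ c ≠ 0) (l u : ℝ) : 0 < confLength γ l u := by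
  have := hγ.continuous
  exact integral_speed_pos hγ hc hP (f := fun s => confWeight γ l u s) (by fun_prop)
    (confWeight_pos γ l u)

lemma confSqLength_pos (hγ : ContDiff ℝ 1 γ) (hP : Function.Periodic γ (2 * π)) {c : ℝ}
    (hc : deriv γ c ≠ 0) (l u : ℝ) : 0 < confSqLength γ l u := by
  have := hγ.continuous
  exact integral_speed_pos hγ hc hP (f := fun s => confWeight γ l u s ^ 2) (by fun_prop)
    (fun s => pow_pos (confWeight_pos γ l u s) 2)

/-- The moment inequality expressing Wirtinger's inequality on the inverse stereographic image. -/
lemma confWeight_moment_le (hγ : ContDiff ℝ 1 γ) (hP : Function.Periodic γ (2 * π))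
    {c : ℝ} (hc : deriv γ c ≠ 0) (l u : ℝ) :
    confSqLength γ l u
        * ∑ i, (∫ s in (0 : ℝ)..(2 * π), confWeight γ l u s ^ 2 * ‖deriv γ s‖ * (γ s i - γ u i) ^ 2)
      - ∑ i, (∫ s in (0 : ℝ)..(2 * π), confWeight γ l u s ^ 2 * ‖deriv γ s‖ * (γ s i - γ u i)) ^ 2
      ≤ confLength γ l u ^ 4 / (4 * π ^ 2) := by
  have hcγ := hγ.continuous
  have hcd : Continuous (deriv γ) := hγ.continuous_deriv le_rfl
  have hdP := hP.deriv
  have hd : ∀ s i, HasDerivAt (fun s => γ s i) (deriv γ s i) s := by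
    intro s i
    exact (EuclideanSpace.proj (𝕜 := ℝ) i).hasFDerivAt.comp_hasDerivAt s
      ((hγ.differentiable one_ne_zero) s).hasDerivAt
  set f : ℝ → ℝ := fun s => confWeight γ l u s with hf
  have hfc : Continuous f := by fun_prop
  set d : ℝ → ℝ := fun s => ∑ i, (γ s i - γ u i) ^ 2 with hddef
  have hdn : ∀ s, ‖γ s - γ u‖ ^ 2 = d s := by
    intro s
    simp [EuclideanSpace.norm_sq_eq, hddef]
  have hvn : ∀ s, ‖deriv γ s‖ ^ 2 = ∑ i, deriv γ s i ^ 2 := by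
    intro s
    simp [EuclideanSpace.norm_sq_eq]
  set e : ℝ → ℝ := fun s => ∑ i, (γ s i - γ u i) * deriv γ s i with he
  have hec : Continuous e := by fun_prop
  have hdc : Continuous d := by fun_prop
  have hf1 : ∀ s, f s * (1 + l ^ 2 * d s) = 1 := fun s => by
    rw [← hdn]; exact confWeight_mul γ l u s
  have hf1' : ∀ s, f s = 1 / (1 + l ^ 2 * d s) := fun s => by
    rw [← hdn]; rfl
  have hD : ∀ s, 0 < 1 + l ^ 2 * d s := fun s => by rw [← hdn]; positivity
  have hdd : ∀ s, HasDerivAt d (2 * e s) s := by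
    intro s
    have := HasDerivAt.fun_sum (u := Finset.univ)
      fun i _ => (((hd s i).sub_const (γ u i)).pow 2)
    refine this.congr_deriv ?_
    simp only [he, Finset.mul_sum]
    refine Finset.sum_congr rfl fun i _ => ?_
    simp
    ring
  have hfd : ∀ s, HasDerivAt f (-(2 * l ^ 2 * e s * f s ^ 2)) s := by
    intro s
    have := (((hdd s).const_mul (l ^ 2)).const_add 1).fun_inv (hD s).ne'
    have hfe : f = fun s => (1 + l ^ 2 * d s)⁻¹ := by
      ext s; rw [hf1', one_div]
    rw [hfe]
    refine this.congr_deriv ?_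
    have := (hD s).ne'
    field_simp
  set z : Option ι → ℝ → ℝ := fun o s =>
    o.elim (l * d s * f s) (fun i => (γ s i - γ u i) * f s) with hzdef
  set z' : Option ι → ℝ → ℝ := fun o s => o.elim (2 * l * e s * f s ^ 2)
    (fun i => deriv γ s i * f s + (γ s i - γ u i) * (-(2 * l ^ 2 * e s * f s ^ 2))) with hz'def
  have hfP : Function.Periodic f (2 * π) := by
    intro s; simp only [hf, confWeight, hP s]
  have hdPer : Function.Periodic d (2 * π) := by
    intro s; simp only [hddef, hP s]
  have hW := wirtinger_weighted (P := 2 * π) z (fun s => f s * ‖deriv γ s‖) (by fun_prop)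
    (fun s => by simp only [hfP s, hdP s]) (confLength_pos hγ hP hc l u)
    (by
      rintro (_ | i) s
      · simp only [hzdef, Option.elim, hfP s, hdPer s]
      · simp only [hzdef, Option.elim, hfP s, hP s])
    (sum_sq_sub_le_of_hasDerivAt z z' _ (by fun_prop)
      (fun s => mul_nonneg (confWeight_pos γ l u s).le (norm_nonneg _))
      (by
        rintro (_ | i) s
        · refine (((hdd s).const_mul l).mul (hfd s)).congr_deriv ?_
          simp only [hz'def, Option.elim]
          linear_combination (-(2 * l * e s * f s)) * (hf1 s)
        · exact ((hd s i).sub_const _).mul (hfd s))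
      (by
        rintro (_ | i)
        · simp only [hz'def, Option.elim]; fun_prop
        · simp only [hz'def, Option.elim]; fun_prop)
      (by
        intro s
        rw [Fintype.sum_option]
        simp only [hz'def, Option.elim]
        have h1 : ∑ i, (deriv γ s i * f s + (γ s i - γ u i) * (-(2 * l ^ 2 * e s * f s ^ 2))) ^ 2
            = f s ^ 2 * ∑ i, deriv γ s i ^ 2 - (4 * l ^ 2 * e s * f s ^ 3) * e s
              + 4 * l ^ 4 * e s ^ 2 * f s ^ 4 * d s := by
          conv_rhs =>
            rw [hddef]
            enter [1, 2, 2]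
            rw [he]
          simp only [Finset.mul_sum]
          rw [← Finset.sum_sub_distrib, ← Finset.sum_add_distrib]
          refine Finset.sum_congr rfl fun i _ => ?_
          ring
        rw [h1, mul_pow (f s), hvn]
        refine le_of_eq ?_
        linear_combination (4 * l ^ 2 * e s ^ 2 * f s ^ 3) * hf1 s))
  rw [Fintype.sum_option, Fintype.sum_option] at hW
  simp only [hzdef, Option.elim] at hW
  have hJ1 : ∫ s in (0 : ℝ)..(2 * π), f s * ‖deriv γ s‖ = confLength γ l u := rfl
  have hJ2 : ∫ s in (0 : ℝ)..(2 * π), f s ^ 2 * ‖deriv γ s‖ = confSqLength γ l u := rfl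
  set Q := ∫ s in (0 : ℝ)..(2 * π), f s ^ 2 * ‖deriv γ s‖ * d s with hQ
  have hQs : ∑ i, (∫ s in (0 : ℝ)..(2 * π), f s ^ 2 * ‖deriv γ s‖ * (γ s i - γ u i) ^ 2) = Q := by
    rw [← intervalIntegral.integral_finsetSum
      (fun i _ => Continuous.intervalIntegrable (by fun_prop) _ _)]
    simp only [← Finset.mul_sum, hQ, hddef]
  have hl : l ^ 2 * Q = confLength γ l u - confSqLength γ l u := by
    rw [← hJ1, ← hJ2, ← intervalIntegral.integral_sub
      (Continuous.intervalIntegrable (by fun_prop) _ _)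
      (Continuous.intervalIntegrable (by fun_prop) _ _), hQ,
      ← intervalIntegral.integral_const_mul]
    congr 1
    ext s
    linear_combination (f s * ‖deriv γ s‖) * hf1 s
  have h4 : ∫ s in (0 : ℝ)..(2 * π), l * d s * f s * (f s * ‖deriv γ s‖) = l * Q := by
    rw [hQ, ← intervalIntegral.integral_const_mul]
    congr 1
    ext s
    ring
  have h5 : (∫ s in (0 : ℝ)..(2 * π), (l * d s * f s) ^ 2 * (f s * ‖deriv γ s‖))
      + ∑ i, (∫ s in (0 : ℝ)..(2 * π), ((γ s i - γ u i) * f s) ^ 2 * (f s * ‖deriv γ s‖)) = Q := by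
    rw [← intervalIntegral.integral_finsetSum
      (fun i _ => Continuous.intervalIntegrable (by fun_prop) _ _),
      ← intervalIntegral.integral_add
      (Continuous.intervalIntegrable (by fun_prop) _ _)
      (Continuous.intervalIntegrable (by fun_prop) _ _), hQ]
    congr 1
    ext s
    have : ∑ i, ((γ s i - γ u i) * f s) ^ 2 * (f s * ‖deriv γ s‖)
        = d s * (f s ^ 3 * ‖deriv γ s‖) := by
      simp only [hddef, Finset.sum_mul]
      refine Finset.sum_congr rfl fun i _ => ?_
      ring
    rw [this]
    linear_combination (d s * f s ^ 2 * ‖deriv γ s‖) * hf1 s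
  have h6 : ∀ i, ∫ s in (0 : ℝ)..(2 * π), (γ s i - γ u i) * f s * (f s * ‖deriv γ s‖)
      = ∫ s in (0 : ℝ)..(2 * π), f s ^ 2 * ‖deriv γ s‖ * (γ s i - γ u i) := by
    intro i
    congr 1
    ext s
    ring
  rw [h5, h4] at hW
  simp only [h6] at hW
  rw [hJ1] at hW
  rw [hQs]
  refine le_trans (le_of_eq ?_) hW
  linear_combination Q * hl

/-- The first moment about a point, in each coordinate. -/
lemma integral_confWeight_sq_mul_sub (hγ : ContDiff ℝ 1 γ) (hP : Function.Periodic γ (2 * π))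
    {c : ℝ} (hc : deriv γ c ≠ 0) (l u p : ℝ) (i : ι) :
    ∫ s in (0 : ℝ)..(2 * π), confWeight γ l u s ^ 2 * ‖deriv γ s‖ * (γ s i - p)
      = confSqLength γ l u * (confCenter γ l u i - p) := by
  have hcγ := hγ.continuous
  have hcd : Continuous (deriv γ) := hγ.continuous_deriv le_rfl
  have hJ2 := confSqLength_pos hγ hP hc l u
  simp only [mul_sub, confCenter]
  rw [intervalIntegral.integral_sub (Continuous.intervalIntegrable (by fun_prop) _ _)
    (Continuous.intervalIntegrable (by fun_prop) _ _), intervalIntegral.integral_mul_const,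
    mul_div_cancel₀ _ hJ2.ne']
  rfl

/-- The parallel axis theorem for the squared conformal weight, in each coordinate. -/
lemma integral_confWeight_sq_mul_sub_sq (hγ : ContDiff ℝ 1 γ) (hP : Function.Periodic γ (2 * π))
    {c : ℝ} (hc : deriv γ c ≠ 0) (l u p : ℝ) (i : ι) :
    ∫ s in (0 : ℝ)..(2 * π), confWeight γ l u s ^ 2 * ‖deriv γ s‖ * (γ s i - p) ^ 2
      = (∫ s in (0 : ℝ)..(2 * π),
          confWeight γ l u s ^ 2 * ‖deriv γ s‖ * (γ s i - confCenter γ l u i) ^ 2)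
        + confSqLength γ l u * (confCenter γ l u i - p) ^ 2 := by
  have hcγ := hγ.continuous
  have hcd : Continuous (deriv γ) := hγ.continuous_deriv le_rfl
  set m := confCenter γ l u i
  have h1 := integral_confWeight_sq_mul_sub hγ hP hc l u m i
  have h2 : confSqLength γ l u
    = ∫ s in (0 : ℝ)..(2 * π), confWeight γ l u s ^ 2 * ‖deriv γ s‖ := rfl
  rw [sub_self, mul_zero] at h1
  have h3 : ∫ s in (0 : ℝ)..(2 * π), confWeight γ l u s ^ 2 * ‖deriv γ s‖ * (γ s i - p) ^ 2
      = (∫ s in (0 : ℝ)..(2 * π), confWeight γ l u s ^ 2 * ‖deriv γ s‖ * (γ s i - m) ^ 2)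
        + 2 * (m - p) * (∫ s in (0 : ℝ)..(2 * π),
          confWeight γ l u s ^ 2 * ‖deriv γ s‖ * (γ s i - m))
        + (∫ s in (0 : ℝ)..(2 * π), confWeight γ l u s ^ 2 * ‖deriv γ s‖) * (m - p) ^ 2 := by
    rw [← intervalIntegral.integral_const_mul,
      ← intervalIntegral.integral_mul_const, ← intervalIntegral.integral_add
      (Continuous.intervalIntegrable (by fun_prop) _ _)
      (Continuous.intervalIntegrable (by fun_prop) _ _), ← intervalIntegral.integral_add
      (Continuous.intervalIntegrable (by fun_prop) _ _)
      (Continuous.intervalIntegrable (by fun_prop) _ _)]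
    congr 1
    ext s
    ring
  rw [h3, h1, h2]
  ring

/-- The second moment of a curve about a point, for the squared normalized conformal weight. -/
def confMoment (γ : ℝ → EuclideanSpace ℝ ι) (l u : ℝ) (p : EuclideanSpace ℝ ι) : ℝ :=
  ∫ s in (0 : ℝ)..(2 * π), (confWeight γ l u s / confLength γ l u) ^ 2 * ‖deriv γ s‖
    * ‖γ s - p‖ ^ 2

lemma confMoment_eq_sum (hγ : ContDiff ℝ 1 γ) (l u : ℝ) (p : EuclideanSpace ℝ ι) :
    confMoment γ l u p = (∑ i, ∫ s in (0 : ℝ)..(2 * π),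
      confWeight γ l u s ^ 2 * ‖deriv γ s‖ * (γ s i - p i) ^ 2) / confLength γ l u ^ 2 := by
  have hcγ := hγ.continuous
  have hcd : Continuous (deriv γ) := hγ.continuous_deriv le_rfl
  rw [← intervalIntegral.integral_finsetSum
      (fun i _ => Continuous.intervalIntegrable (by fun_prop) _ _), confMoment,
      ← intervalIntegral.integral_div]
  congr 1
  ext s
  have : ‖γ s - p‖ ^ 2 = ∑ i, (γ s i - p i) ^ 2 := by simp [EuclideanSpace.norm_sq_eq]
  rw [this, ← Finset.mul_sum]
  ring

lemma confMoment_eq_add (hγ : ContDiff ℝ 1 γ) (hP : Function.Periodic γ (2 * π))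
    {c : ℝ} (hc : deriv γ c ≠ 0) (l u : ℝ) (p : EuclideanSpace ℝ ι) :
    confMoment γ l u p = confMoment γ l u (confCenter γ l u)
      + confConc γ l u * ‖confCenter γ l u - p‖ ^ 2 := by
  rw [confMoment_eq_sum hγ, confMoment_eq_sum hγ]
  simp only [integral_confWeight_sq_mul_sub_sq hγ hP hc l u (p _)]
  have : ‖confCenter γ l u - p‖ ^ 2 = ∑ i, (confCenter γ l u i - p i) ^ 2 := by
    simp [EuclideanSpace.norm_sq_eq]
  rw [Finset.sum_add_distrib, ← Finset.mul_sum, ← this, confConc]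
  ring

/-- The sharp bound for the variance of a closed curve in terms of its concentration. -/
lemma confConc_mul_confMoment_le (hγ : ContDiff ℝ 1 γ) (hP : Function.Periodic γ (2 * π))
    {c : ℝ} (hc : deriv γ c ≠ 0) (l u : ℝ) :
    confConc γ l u * confMoment γ l u (confCenter γ l u) ≤ 1 / (4 * π ^ 2) := by
  have h := confWeight_moment_le hγ hP hc l u
  have hJ1 := confLength_pos hγ hP hc l u
  simp only [integral_confWeight_sq_mul_sub_sq hγ hP hc l u (γ u _),
    integral_confWeight_sq_mul_sub hγ hP hc] at h
  rw [confMoment_eq_sum hγ, confConc, div_mul_div_comm, div_le_div_iff₀ (by positivity)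
    (by positivity)]
  rw [le_div_iff₀ (by positivity), Finset.sum_add_distrib, ← Finset.mul_sum] at h
  simp only [mul_pow] at h
  rw [← Finset.mul_sum] at h
  linarith

/-- The energy bound when the weighted barycentres and the concentrations of both curves agree. -/
lemma two_pi_sq_le_mobiusEnergy_of_confCenter_eq {γ₁ γ₂ : ℝ → EuclideanSpace ℝ ι}
    (h₁ : ContDiff ℝ 1 γ₁) (h₂ : ContDiff ℝ 1 γ₂) (hP₁ : Function.Periodic γ₁ (2 * π))
    (hP₂ : Function.Periodic γ₂ (2 * π)) {c₁ c₂ : ℝ} (hc₁ : deriv γ₁ c₁ ≠ 0)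
    (hc₂ : deriv γ₂ c₂ ≠ 0) (hne : ∀ s t, γ₁ s ≠ γ₂ t) {l u k t : ℝ}
    (hm : confCenter γ₁ l u = confCenter γ₂ k t) (hw : confConc γ₁ l u = confConc γ₂ k t) :
    2 * π ^ 2 ≤ mobiusEnergy γ₁ γ₂ := by
  have hcγ₁ := h₁.continuous
  have hcγ₂ := h₂.continuous
  have hcd₁ : Continuous (deriv γ₁) := h₁.continuous_deriv le_rfl
  have hcd₂ : Continuous (deriv γ₂) := h₂.continuous_deriv le_rfl
  set a : ℝ → ℝ := fun s => confWeight γ₁ l u s / confLength γ₁ l u with ha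
  set b : ℝ → ℝ := fun s => confWeight γ₂ k t s / confLength γ₂ k t with hb
  have hac : Continuous a := by fun_prop
  have hbc : Continuous b := by fun_prop
  have hJ₁ := confLength_pos h₁ hP₁ hc₁ l u
  have hJ₂ := confLength_pos h₂ hP₂ hc₂ k t
  have ha1 : ∫ s in (0 : ℝ)..(2 * π), a s * ‖deriv γ₁ s‖ = 1 := by
    simp only [ha, div_mul_eq_mul_div]
    rw [intervalIntegral.integral_div]
    exact div_self hJ₁.ne'
  have hb1 : ∫ s in (0 : ℝ)..(2 * π), b s * ‖deriv γ₂ s‖ = 1 := by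
    simp only [hb, div_mul_eq_mul_div]
    rw [intervalIntegral.integral_div]
    exact div_self hJ₂.ne'
  have ha2 : ∫ s in (0 : ℝ)..(2 * π), a s ^ 2 * ‖deriv γ₁ s‖ = confConc γ₁ l u := by
    simp only [ha, div_mul_eq_mul_div, div_pow]
    rw [intervalIntegral.integral_div]
    rfl
  have hMb : ∀ x, ∫ r in (0 : ℝ)..(2 * π), b r ^ 2 * ‖deriv γ₂ r‖ * ‖x - γ₂ r‖ ^ 2
      = confMoment γ₂ k t (confCenter γ₂ k t)
        + confConc γ₂ k t * ‖x - confCenter γ₂ k t‖ ^ 2 := by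
    intro x
    have := confMoment_eq_add h₂ hP₂ hc₂ k t x
    rw [norm_sub_rev, ← this]
    simp only [norm_sub_rev x]
    rfl
  have hMa : ∫ s in (0 : ℝ)..(2 * π),
      a s ^ 2 * ‖deriv γ₁ s‖ * ‖γ₁ s - confCenter γ₂ k t‖ ^ 2
      = confMoment γ₁ l u (confCenter γ₁ l u) := by
    rw [← hm]; rfl
  have hVa := confConc_mul_confMoment_le h₁ hP₁ hc₁ l u
  have hVb := confConc_mul_confMoment_le h₂ hP₂ hc₂ k t
  have hqpos : ∀ s r, 0 < ‖γ₁ s - γ₂ r‖ ^ 2 := fun s r => by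
    have := norm_pos_iff.mpr (sub_ne_zero.mpr (hne s r))
    positivity
  have hjoint : Continuous fun p : ℝ × ℝ =>
      ‖deriv γ₁ p.1‖ * ‖deriv γ₂ p.2‖ / ‖γ₁ p.1 - γ₂ p.2‖ ^ 2 :=
    Continuous.div (by fun_prop) (by fun_prop) fun p => (hqpos p.1 p.2).ne'
  set V := confMoment γ₂ k t (confCenter γ₂ k t)
  set w := confConc γ₂ k t
  have hpt : ∀ s r, 4 * π ^ 2 * (a s * ‖deriv γ₁ s‖ * (b r * ‖deriv γ₂ r‖))
      - 4 * π ^ 4 * (a s ^ 2 * ‖deriv γ₁ s‖ * (b r ^ 2 * ‖deriv γ₂ r‖ * ‖γ₁ s - γ₂ r‖ ^ 2))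
      ≤ ‖deriv γ₁ s‖ * ‖deriv γ₂ r‖ / ‖γ₁ s - γ₂ r‖ ^ 2 := by
    intro s r
    set q := ‖γ₁ s - γ₂ r‖ ^ 2
    have hq : 0 < q := hqpos s r
    rw [le_div_iff₀ hq]
    have : 0 ≤ ‖deriv γ₁ s‖ * ‖deriv γ₂ r‖ * (1 - 2 * π ^ 2 * (a s * b r) * q) ^ 2 := by positivity
    linarith
  have hin : ∀ s, 4 * π ^ 2 * (a s * ‖deriv γ₁ s‖)
      - 4 * π ^ 4 * (a s ^ 2 * ‖deriv γ₁ s‖ * V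
        + w * (a s ^ 2 * ‖deriv γ₁ s‖ * ‖γ₁ s - confCenter γ₂ k t‖ ^ 2))
      ≤ ∫ r in (0 : ℝ)..(2 * π), ‖deriv γ₁ s‖ * ‖deriv γ₂ r‖ / ‖γ₁ s - γ₂ r‖ ^ 2 := by
    intro s
    have := intervalIntegral.integral_mono_on (μ := volume) (a := 0) (b := 2 * π) (by positivity)
      (Continuous.intervalIntegrable (by fun_prop) _ _)
      ((hjoint.comp (by fun_prop : Continuous fun r : ℝ => (s, r))).intervalIntegrable _ _)
      (fun r _ => hpt s r)
    refine le_trans (le_of_eq ?_) this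
    rw [intervalIntegral.integral_sub (Continuous.intervalIntegrable (by fun_prop) _ _)
      (Continuous.intervalIntegrable (by fun_prop) _ _)]
    simp only [intervalIntegral.integral_const_mul]
    rw [hb1, hMb]
    ring
  have hout := intervalIntegral.integral_mono_on (μ := volume) (a := 0) (b := 2 * π)
    (by positivity) (Continuous.intervalIntegrable (by fun_prop) _ _)
    ((intervalIntegral.continuous_parametric_intervalIntegral_of_continuous' hjoint 0
      (2 * π)).intervalIntegrable _ _) (fun s _ => hin s)
  refine le_trans ?_ hout
  rw [intervalIntegral.integral_sub (Continuous.intervalIntegrable (by fun_prop) _ _)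
      (Continuous.intervalIntegrable (by fun_prop) _ _), intervalIntegral.integral_const_mul,
      intervalIntegral.integral_const_mul, intervalIntegral.integral_add
      (Continuous.intervalIntegrable (by fun_prop) _ _)
      (Continuous.intervalIntegrable (by fun_prop) _ _), intervalIntegral.integral_const_mul,
      intervalIntegral.integral_mul_const, ha1, ha2, hMa, hw]
  rw [hw] at hVa
  have h3 := mul_le_mul_of_nonneg_left (add_le_add hVb hVa)
    (by positivity : (0 : ℝ) ≤ 4 * π ^ 4)
  have h4 : 4 * π ^ 4 * (1 / (4 * π ^ 2) + 1 / (4 * π ^ 2)) = 2 * π ^ 2 := by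
    have := pi_pos.ne'
    field_simp
    ring
  rw [h4] at h3
  linarith

end ConformalWeights

lemma Function.Periodic.integral_pos {g : ℝ → ℝ} {P : ℝ} (hgP : Function.Periodic g P)
    (hP : 0 < P) (hg : Continuous g) (hg0 : ∀ s, 0 ≤ g s) {c : ℝ} (hc : 0 < g c) :
    0 < ∫ s in (0 : ℝ)..P, g s := by
  obtain ⟨y, hy, hcy⟩ := hgP.exists_mem_Ico₀ hP c
  exact intervalIntegral.integral_pos hP hg.continuousOn (fun s _ => hg0 s)
    ⟨y, Set.Ico_subset_Icc_self hy, hcy ▸ hc⟩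

section Concentration

variable {ι : Type*} [Fintype ι] {γ : ℝ → EuclideanSpace ℝ ι}

lemma hasDerivAt_norm_sub_sq (hγ : ContDiff ℝ 1 γ) (p : EuclideanSpace ℝ ι) (s : ℝ) :
    HasDerivAt (fun s => ‖γ s - p‖ ^ 2) (2 * inner ℝ (γ s - p) (deriv γ s)) s :=
  (((hγ.differentiable one_ne_zero) s).hasDerivAt.sub_const p).norm_sq

/-- If the distance of a curve to one of its points is constant wherever the curve moves, then
the curve is at rest. -/
lemma deriv_eq_zero_of_norm_sub_sq_eq (hγ : ContDiff ℝ 1 γ) {u k : ℝ}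
    (h : ∀ s, deriv γ s ≠ 0 → ‖γ s - γ u‖ ^ 2 = k) (s : ℝ) : deriv γ s = 0 := by
  have hcd : Continuous (deriv γ) := hγ.continuous_deriv le_rfl
  have hd : ∀ s, deriv (fun s => ‖γ s - γ u‖ ^ 2) s = 0 := by
    intro s
    by_cases hs : deriv γ s = 0
    · rw [(hasDerivAt_norm_sub_sq hγ (γ u) s).deriv, hs, inner_zero_right, mul_zero]
    · have : (fun s => ‖γ s - γ u‖ ^ 2) =ᶠ[nhds s] fun _ => k := by
        filter_upwards [hcd.continuousAt.eventually_ne hs] with r hr using h r hr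
      rw [this.deriv_eq, deriv_const]
  have hconst := is_const_of_deriv_eq_zero
    (fun s => (hasDerivAt_norm_sub_sq hγ (γ u) s).differentiableAt) hd
  have : γ = fun _ => γ u := by
    ext1 s
    have := hconst s u
    simpa [sub_eq_zero] using this
  rw [this, deriv_const]

/-- The normalized weight `confWeight γ l u / confLength γ l u` is the unique minimizer of the
penalized energy `∫ ρ² (1 + l² ‖γ - γ u‖²)` among probability densities. -/
lemma confConc_add_lt (hγ : ContDiff ℝ 1 γ) (hP : Function.Periodic γ (2 * π))
    {c : ℝ} (hc : deriv γ c ≠ 0) (u : ℝ) {l k : ℝ} (hlk : l ^ 2 ≠ k ^ 2) :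
    confConc γ l u + l ^ 2 * confMoment γ l u (γ u)
      < confConc γ k u + l ^ 2 * confMoment γ k u (γ u) := by
  have hcγ := hγ.continuous
  have hcd : Continuous (deriv γ) := hγ.continuous_deriv le_rfl
  have hdP := hP.deriv
  set J := confLength γ l u with hJ
  set K := confLength γ k u with hK
  have hJ0 : 0 < J := confLength_pos hγ hP hc l u
  have hK0 : 0 < K := confLength_pos hγ hP hc k u
  set f : ℝ → ℝ := fun s => confWeight γ l u s with hf
  set g : ℝ → ℝ := fun s => confWeight γ k u s with hg
  set x : ℝ → ℝ := fun s => ‖γ s - γ u‖ ^ 2 with hx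
  have hfc : Continuous f := by fun_prop
  have hgc : Continuous g := by fun_prop
  have hxc : Continuous x := by fun_prop
  have hfx : ∀ s, f s * (1 + l ^ 2 * x s) = 1 := confWeight_mul γ l u
  have hgx : ∀ s, g s * (1 + k ^ 2 * x s) = 1 := confWeight_mul γ k u
  have hf0 : ∀ s, 0 < f s := confWeight_pos γ l u
  have hg0 : ∀ s, 0 < g s := confWeight_pos γ k u
  have hIf : ∫ s in (0 : ℝ)..(2 * π), f s * ‖deriv γ s‖ = J := rfl
  have hIg : ∫ s in (0 : ℝ)..(2 * π), g s * ‖deriv γ s‖ = K := rfl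
  have hsum : ∀ m : ℝ, confConc γ m u + l ^ 2 * confMoment γ m u (γ u)
      = ∫ s in (0 : ℝ)..(2 * π),
        (confWeight γ m u s / confLength γ m u) ^ 2 * (1 + l ^ 2 * x s) * ‖deriv γ s‖ := by
    intro m
    rw [confConc, confSqLength, confMoment, ← intervalIntegral.integral_div,
      ← intervalIntegral.integral_const_mul, ← intervalIntegral.integral_add
      (Continuous.intervalIntegrable (by fun_prop) _ _)
      (Continuous.intervalIntegrable (by fun_prop) _ _)]
    congr 1
    ext s
    ring
  set D : ℝ → ℝ := fun s => (g s / K - f s / J) ^ 2 * (1 + l ^ 2 * x s) * ‖deriv γ s‖ with hD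
  have hDI : ∫ s in (0 : ℝ)..(2 * π), D s
      = confConc γ k u + l ^ 2 * confMoment γ k u (γ u)
        - (confConc γ l u + l ^ 2 * confMoment γ l u (γ u)) := by
    have h1 : ∫ s in (0 : ℝ)..(2 * π), D s
        = (∫ s in (0 : ℝ)..(2 * π), (g s / K) ^ 2 * (1 + l ^ 2 * x s) * ‖deriv γ s‖)
          - (∫ s in (0 : ℝ)..(2 * π), (f s / J) ^ 2 * (1 + l ^ 2 * x s) * ‖deriv γ s‖)
          - 2 / J * ((∫ s in (0 : ℝ)..(2 * π), g s * ‖deriv γ s‖) / K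
            - (∫ s in (0 : ℝ)..(2 * π), f s * ‖deriv γ s‖) / J) := by
      rw [← intervalIntegral.integral_div, ← intervalIntegral.integral_div,
        ← intervalIntegral.integral_sub (Continuous.intervalIntegrable (by fun_prop) _ _)
        (Continuous.intervalIntegrable (by fun_prop) _ _),
        ← intervalIntegral.integral_sub (Continuous.intervalIntegrable (by fun_prop) _ _)
        (Continuous.intervalIntegrable (by fun_prop) _ _),
        ← intervalIntegral.integral_const_mul,
        ← intervalIntegral.integral_sub (Continuous.intervalIntegrable (by fun_prop) _ _)
        (Continuous.intervalIntegrable (by fun_prop) _ _)]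
      congr 1
      ext s
      simp only [hD]
      linear_combination (-2 / J * (g s / K - f s / J) * ‖deriv γ s‖) * hfx s
    rw [h1, hIf, hIg, div_self hJ0.ne', div_self hK0.ne', hsum, hsum]
    ring
  by_contra! hle
  have hD0 : ∀ s, 0 ≤ D s := fun s => by positivity
  have hDP : Function.Periodic D (2 * π) := by
    intro s; simp only [hD, hf, hg, hx, confWeight, hP s, hdP s]
  have hDz : ∀ s, D s = 0 := by
    intro s
    by_contra h
    have := hDP.integral_pos (by positivity) (by fun_prop) hD0 (lt_of_le_of_ne (hD0 s) (Ne.symm h))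
    linarith
  have hrel : ∀ s, deriv γ s ≠ 0 → (K * k ^ 2 - J * l ^ 2) * x s = J - K := by
    intro s hs
    have h1 : 0 < 1 + l ^ 2 * x s := by positivity
    have h2 := hDz s
    simp only [hD] at h2
    have h3 : g s / K - f s / J = 0 := by
      simpa [h1.ne', hs] using h2
    rw [sub_eq_zero, div_eq_div_iff hK0.ne' hJ0.ne'] at h3
    linear_combination (-(1 + l ^ 2 * x s) * (1 + k ^ 2 * x s)) * h3
      + (J * (1 + l ^ 2 * x s)) * hgx s - (K * (1 + k ^ 2 * x s)) * hfx s
  by_cases hα : K * k ^ 2 - J * l ^ 2 = 0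
  · have h1 := hrel c hc
    rw [hα, zero_mul] at h1
    have h2 : J = K := by linarith
    rw [h2, ← mul_sub] at hα
    rcases mul_eq_zero.mp hα with h | h
    · exact hK0.ne' h
    · exact hlk (by linarith)
  · refine hc (deriv_eq_zero_of_norm_sub_sq_eq hγ
      (k := (J - K) / (K * k ^ 2 - J * l ^ 2)) (u := u) (fun s hs => ?_) c)
    rw [eq_div_iff hα, mul_comm]
    exact hrel s hs

lemma confConc_strictMonoOn (hγ : ContDiff ℝ 1 γ) (hP : Function.Periodic γ (2 * π))
    {c : ℝ} (hc : deriv γ c ≠ 0) (u : ℝ) :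
    StrictMonoOn (fun l => confConc γ l u) (Set.Ici 0) := by
  intro l hl k hk hlk
  have hl' : 0 ≤ l := hl
  have hsq : l ^ 2 < k ^ 2 := by gcongr
  have h1 := confConc_add_lt hγ hP hc u hsq.ne
  have h2 := confConc_add_lt hγ hP hc u hsq.ne'
  have h3 : confMoment γ k u (γ u) < confMoment γ l u (γ u) := by
    by_contra! h
    nlinarith
  change confConc γ l u < confConc γ k u
  nlinarith [sq_nonneg l]

end Concentration

lemma sq_integral_mul_le {f g v : ℝ → ℝ} (hf : Continuous f) (hg : Continuous g)
    (hv : Continuous v) (hv0 : ∀ s, 0 ≤ v s) {a b : ℝ} (hab : a ≤ b) :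
    (∫ s in a..b, f s * g s * v s) ^ 2
      ≤ (∫ s in a..b, f s ^ 2 * v s) * ∫ s in a..b, g s ^ 2 * v s := by
  set A := ∫ s in a..b, f s ^ 2 * v s with hA
  set B := ∫ s in a..b, f s * g s * v s with hB
  set C := ∫ s in a..b, g s ^ 2 * v s with hC
  have h : ∀ x : ℝ, 0 ≤ A * (x * x) + 2 * B * x + C := by
    intro x
    have h1 : A * (x * x) + 2 * B * x + C = ∫ s in a..b, (x * f s + g s) ^ 2 * v s := by
      rw [hA, hB, hC, ← intervalIntegral.integral_const_mul, ← intervalIntegral.integral_mul_const,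
        ← intervalIntegral.integral_mul_const, ← intervalIntegral.integral_add
        (Continuous.intervalIntegrable (by fun_prop) _ _)
        (Continuous.intervalIntegrable (by fun_prop) _ _), ← intervalIntegral.integral_add
        (Continuous.intervalIntegrable (by fun_prop) _ _)
        (Continuous.intervalIntegrable (by fun_prop) _ _)]
      congr 1
      ext s
      ring
    rw [h1]
    exact intervalIntegral.integral_nonneg hab fun s _ => mul_nonneg (sq_nonneg _) (hv0 s)
  have := discrim_le_zero h
  rw [discrim] at this
  linarith

section Limit

variable {ι : Type*} [Fintype ι] {γ : ℝ → EuclideanSpace ℝ ι}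

lemma exists_norm_sub_le (hγ : Continuous γ) (hP : Function.Periodic γ (2 * π)) :
    ∃ D, 0 < D ∧ ∀ s u, ‖γ s - γ u‖ ≤ D := by
  obtain ⟨C, hC⟩ := (hP.compact_of_continuous two_pi_pos.ne' hγ).isBounded.exists_norm_le
  have hC' : ∀ s, ‖γ s‖ ≤ C := fun s => hC _ ⟨s, rfl⟩
  refine ⟨2 * C + 1, by linarith [(norm_nonneg _).trans (hC' 0)], fun s u => ?_⟩
  linarith [norm_sub_le (γ s) (γ u), hC' s, hC' u]

/-- A differentiable curve passes through a given point with nonzero velocity only countably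
often. -/
lemma countable_setOf_eq_and_deriv_ne_zero {E : Type*} [NormedAddCommGroup E] [NormedSpace ℝ E]
    {f : ℝ → E} (hf : Differentiable ℝ f) (p : E) : {s | f s = p ∧ deriv f s ≠ 0}.Countable := by
  set S := {s | f s = p ∧ deriv f s ≠ 0} with hS
  have : DiscreteTopology S := by
    rw [discreteTopology_subtype_iff]
    intro s hs
    rw [← Filter.empty_mem_iff_bot, Filter.mem_inf_iff]
    refine ⟨{r | f r ≠ p}, (hf s).hasDerivAt.eventually_ne hs.2, S, Filter.mem_principal_self S, ?_⟩
    ext r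
    simp only [Set.mem_empty_iff_false, Set.mem_inter_iff, false_iff, not_and]
    exact fun h1 h2 => h1 h2.1
  exact Set.countable_coe_iff.mp (TopologicalSpace.separableSpace_iff_countable.mp inferInstance)

lemma confSqLength_le_confLength (hγ : ContDiff ℝ 1 γ) (l u : ℝ) :
    confSqLength γ l u ≤ confLength γ l u := by
  have hcγ := hγ.continuous
  have hcd : Continuous (deriv γ) := hγ.continuous_deriv le_rfl
  refine intervalIntegral.integral_mono_on (by positivity)
    (Continuous.intervalIntegrable (by fun_prop) _ _)
    (Continuous.intervalIntegrable (by fun_prop) _ _) fun s _ => ?_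
  refine mul_le_mul_of_nonneg_right ?_ (norm_nonneg _)
  exact pow_le_of_le_one (confWeight_pos γ l u s).le (confWeight_le_one γ l u s) two_ne_zero

lemma tendsto_confLength_atTop (hγ : ContDiff ℝ 1 γ) (u : ℝ) :
    Filter.Tendsto (fun l => confLength γ l u) Filter.atTop (nhds 0) := by
  have hcγ := hγ.continuous
  have hcd : Continuous (deriv γ) := hγ.continuous_deriv le_rfl
  have h0 : (0 : ℝ) = ∫ s in (0 : ℝ)..(2 * π), (fun _ => (0 : ℝ)) s := by simp
  rw [h0]
  refine intervalIntegral.tendsto_integral_filter_of_dominated_convergence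
    (fun s => ‖deriv γ s‖) (.of_forall fun l => ?_) (.of_forall fun l => .of_forall fun s _ => ?_)
    (Continuous.intervalIntegrable (by fun_prop) _ _) ?_
  · exact Continuous.aestronglyMeasurable (by fun_prop)
  · rw [norm_mul, norm_norm, Real.norm_of_nonneg (confWeight_pos γ l u s).le]
    exact mul_le_of_le_one_left (norm_nonneg _) (confWeight_le_one γ l u s)
  · have hnull := (countable_setOf_eq_and_deriv_ne_zero (hγ.differentiable one_ne_zero)
      (γ u)).measure_zero volume
    filter_upwards [compl_mem_ae_iff.mpr hnull] with s hs _
    by_cases hd : deriv γ s = 0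
    · simp [hd]
    · have hne : γ s ≠ γ u := fun h => hs ⟨h, hd⟩
      have hx : 0 < ‖γ s - γ u‖ ^ 2 := by
        have := norm_pos_iff.mpr (sub_ne_zero.mpr hne)
        positivity
      rw [← zero_mul ‖deriv γ s‖]
      refine Filter.Tendsto.mul_const _ ?_
      unfold confWeight
      refine Filter.Tendsto.const_div_atTop ?_ _
      refine Filter.tendsto_atTop_add_const_left _ _ ?_
      exact (Filter.tendsto_pow_atTop two_ne_zero).atTop_mul_const hx

/-- The squared weight controls the radial extent of the curve. -/
lemma div_le_confSqLength (hγ : ContDiff ℝ 1 γ) (hP : Function.Periodic γ (2 * π)) {D : ℝ}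
    (hD0 : 0 < D) (hD : ∀ s u, ‖γ s - γ u‖ ≤ D) (l u r : ℝ) :
    ‖γ r - γ u‖ ^ 2 / (2 * D * (1 + l ^ 2 * ‖γ r - γ u‖ ^ 2)) ≤ confSqLength γ l u := by
  have hcγ := hγ.continuous
  have hcd : Continuous (deriv γ) := hγ.continuous_deriv le_rfl
  have hPl : Function.Periodic (fun s => confWeight γ l u s ^ 2 * ‖deriv γ s‖) (2 * π) := by
    intro s; simp only [confWeight, hP s, hP.deriv s]
  obtain ⟨y, hy, hry⟩ := hP.exists_mem_Ico (by positivity) r u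
  rw [hry]
  set x : ℝ → ℝ := fun s => ‖γ s - γ u‖ ^ 2 with hx
  have hx0 : ∀ s, 0 ≤ x s := fun s => by positivity
  have h1 : confSqLength γ l u
      = ∫ s in u..(u + 2 * π), confWeight γ l u s ^ 2 * ‖deriv γ s‖ := by
    have := hPl.intervalIntegral_add_eq u 0
    rw [zero_add] at this
    exact this.symm
  have h2 : ∀ s, HasDerivAt (fun s => x s / (1 + l ^ 2 * x s))
      (confWeight γ l u s ^ 2 * (2 * inner ℝ (γ s - γ u) (deriv γ s))) s := by
    intro s
    have hd := hasDerivAt_norm_sub_sq hγ (γ u) s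
    have hpos : 0 < 1 + l ^ 2 * x s := by have := hx0 s; positivity
    refine (hd.div ((hd.const_mul (l ^ 2)).const_add 1) hpos.ne').congr_deriv ?_
    simp only [confWeight]
    change _ / (1 + l ^ 2 * x s) ^ 2 = (1 / (1 + l ^ 2 * x s)) ^ 2 * _
    field_simp
    ring
  have h3 : x y / (1 + l ^ 2 * x y)
      = ∫ s in u..y, confWeight γ l u s ^ 2 * (2 * inner ℝ (γ s - γ u) (deriv γ s)) := by
    rw [intervalIntegral.integral_eq_sub_of_hasDerivAt (fun s _ => h2 s)
      (Continuous.intervalIntegrable (by fun_prop) _ _)]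
    simp [hx]
  have h4 : x y / (1 + l ^ 2 * x y)
      ≤ ∫ s in u..y, 2 * D * (confWeight γ l u s ^ 2 * ‖deriv γ s‖) := by
    rw [h3]
    refine intervalIntegral.integral_mono_on hy.1 (Continuous.intervalIntegrable (by fun_prop) _ _)
      (Continuous.intervalIntegrable (by fun_prop) _ _) fun s _ => ?_
    have h5 : inner ℝ (γ s - γ u) (deriv γ s) ≤ D * ‖deriv γ s‖ :=
      (real_inner_le_norm _ _).trans (mul_le_mul_of_nonneg_right (hD s u) (norm_nonneg _))
    have h6 : 0 ≤ confWeight γ l u s ^ 2 := by positivity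
    nlinarith
  have h7 : ∫ s in u..y, confWeight γ l u s ^ 2 * ‖deriv γ s‖ ≤ confSqLength γ l u := by
    rw [h1]
    refine intervalIntegral.integral_mono_interval le_rfl hy.1 hy.2.le (.of_forall fun s => ?_)
      (Continuous.intervalIntegrable (by fun_prop) _ _)
    simp only [Pi.zero_apply]
    positivity
  rw [intervalIntegral.integral_const_mul] at h4
  have h8 : x y / (2 * D * (1 + l ^ 2 * x y)) = x y / (1 + l ^ 2 * x y) / (2 * D) := by
    rw [div_div, mul_comm (2 * D)]
  rw [h8, div_le_iff₀ (by positivity)]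
  nlinarith

lemma sq_confLength_le (hγ : ContDiff ℝ 1 γ) (u k : ℝ) {l : ℝ} (hl : 0 < l) :
    confLength γ l u ^ 2 ≤ 2 * (confSqLength γ l u * confSqLength γ k u)
      + 2 * (k ^ 2 / l ^ 2 * confLength γ 0 u) ^ 2 := by
  have hcγ := hγ.continuous
  have hcd : Continuous (deriv γ) := hγ.continuous_deriv le_rfl
  have h1 : confLength γ l u ≤ (∫ s in (0 : ℝ)..(2 * π),
      confWeight γ l u s * confWeight γ k u s * ‖deriv γ s‖)
      + k ^ 2 / l ^ 2 * confLength γ 0 u := by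
    unfold confLength
    rw [← intervalIntegral.integral_const_mul, ← intervalIntegral.integral_add
        (Continuous.intervalIntegrable (by fun_prop) _ _)
        (Continuous.intervalIntegrable (by fun_prop) _ _)]
    refine intervalIntegral.integral_mono_on (by positivity)
      (Continuous.intervalIntegrable (by fun_prop) _ _)
      (Continuous.intervalIntegrable (by fun_prop) _ _) fun s _ => ?_
    rw [← mul_assoc, ← add_mul]
    refine mul_le_mul_of_nonneg_right ?_ (norm_nonneg _)
    have hf := confWeight_mul γ l u s
    have hg := confWeight_mul γ k u s
    have h0 : confWeight γ 0 u s = 1 := by simp [confWeight]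
    have hf0 := confWeight_pos γ l u s
    have hg0 := confWeight_pos γ k u s
    have hg1 := confWeight_le_one γ k u s
    set f := confWeight γ l u s
    set g := confWeight γ k u s
    set x := ‖γ s - γ u‖ ^ 2
    have hx : 0 ≤ x := by positivity
    rw [h0, mul_one, ← sub_le_iff_le_add', le_div_iff₀ (by positivity)]
    have h2 : (f - f * g) * l ^ 2 = (f * (l ^ 2 * x)) * g * k ^ 2 := by
      linear_combination (-(f * l ^ 2)) * hg
    have h3 : f * (l ^ 2 * x) ≤ 1 := by nlinarith
    rw [h2]
    have h4 : f * (l ^ 2 * x) * g ≤ 1 := mul_le_one₀ h3 hg0.le hg1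
    nlinarith [sq_nonneg k]
  have h2 := sq_integral_mul_le (f := fun s => confWeight γ l u s)
    (g := fun s => confWeight γ k u s) (v := fun s => ‖deriv γ s‖) (by fun_prop) (by fun_prop)
    (by fun_prop) (fun s => norm_nonneg _) (by positivity : (0 : ℝ) ≤ 2 * π)
  change (∫ s in (0 : ℝ)..(2 * π), confWeight γ l u s * confWeight γ k u s * ‖deriv γ s‖) ^ 2
    ≤ confSqLength γ l u * confSqLength γ k u at h2
  have h0 : 0 ≤ confLength γ l u := intervalIntegral.integral_nonneg (by positivity)
    fun s _ => mul_nonneg (confWeight_pos γ l u s).le (norm_nonneg _)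
  set B := ∫ s in (0 : ℝ)..(2 * π), confWeight γ l u s * confWeight γ k u s * ‖deriv γ s‖
  set C := k ^ 2 / l ^ 2 * confLength γ 0 u
  nlinarith [sq_nonneg (B - C), pow_le_pow_left₀ h0 h1 2]

/-- The density proportional to the conformal weight concentrates as the scale shrinks. -/
lemma tendsto_confConc_atTop (hγ : ContDiff ℝ 1 γ) (hP : Function.Periodic γ (2 * π))
    {c : ℝ} (hc : deriv γ c ≠ 0) (u : ℝ) :
    Filter.Tendsto (fun l => confConc γ l u) Filter.atTop Filter.atTop := by
  obtain ⟨D, hD0, hD⟩ := exists_norm_sub_le hγ.continuous hP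
  obtain ⟨r, hr⟩ : ∃ r, γ r ≠ γ u := by
    by_contra! h
    exact hc (deriv_eq_zero_of_norm_sub_sq_eq hγ (u := u) (k := 0) (fun s _ => by simp [h s]) c)
  have hx : 0 < ‖γ r - γ u‖ ^ 2 := by
    have := norm_pos_iff.mpr (sub_ne_zero.mpr hr)
    positivity
  set x := ‖γ r - γ u‖ ^ 2
  refine Filter.tendsto_atTop.mpr fun M => ?_
  wlog hM : 0 < M generalizing M
  · filter_upwards [this 1 one_pos] with l hl using by linarith
  obtain ⟨k, hk⟩ := ((tendsto_confLength_atTop hγ u).eventually_lt_const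
    (by positivity : 0 < 1 / (4 * M))).exists
  have hk2 : confSqLength γ k u ≤ 1 / (4 * M) := (confSqLength_le_confLength hγ k u).trans hk.le
  have hsq := Filter.tendsto_pow_atTop (α := ℝ) two_ne_zero
  filter_upwards [Filter.eventually_gt_atTop 0, hsq.eventually_ge_atTop (1 / x),
    hsq.eventually_ge_atTop (16 * D * M * k ^ 4 * confLength γ 0 u ^ 2)] with l hl h1 h2
  have hJ1 := confLength_pos hγ hP hc l u
  have hJ2 := confSqLength_pos hγ hP hc l u
  have h3 := sq_confLength_le hγ u k hl
  have h4 := div_le_confSqLength hγ hP hD0 hD l u r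
  rw [div_le_iff₀ hx] at h1
  have h5 : 1 / (4 * D * l ^ 2) ≤ confSqLength γ l u := by
    refine le_trans ?_ h4
    change _ ≤ x / (2 * D * (1 + l ^ 2 * x))
    rw [div_le_div_iff₀ (by positivity) (by positivity)]
    nlinarith
  have h6 : 4 * M * (k ^ 2 / l ^ 2 * confLength γ 0 u) ^ 2 ≤ confSqLength γ l u := by
    refine le_trans ?_ h5
    rw [mul_pow, div_pow, le_div_iff₀ (by positivity)]
    have : 4 * M * ((k ^ 2) ^ 2 / (l ^ 2) ^ 2 * confLength γ 0 u ^ 2) * (4 * D * l ^ 2)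
        = 16 * D * M * k ^ 4 * confLength γ 0 u ^ 2 / l ^ 2 := by
      field_simp
      ring
    rw [this, div_le_one (by positivity)]
    exact h2
  rw [confConc, le_div_iff₀ (by positivity)]
  rw [le_div_iff₀ (by positivity)] at hk2
  nlinarith

end Limit

/-- Strictly increasing families of functions on a half-line can be inverted continuously. -/
lemma exists_continuous_inverse {X : Type*} [TopologicalSpace X] {W : ℝ → X → ℝ}
    (hW : Continuous fun p : ℝ × X => W p.1 p.2) {c : ℝ} (h0 : ∀ x, W 0 x = c)
    (hm : ∀ x, StrictMonoOn (fun l => W l x) (Set.Ici 0))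
    (ht : ∀ x, Filter.Tendsto (fun l => W l x) Filter.atTop Filter.atTop) :
    ∃ L : ℝ → X → ℝ, Continuous (fun p : ℝ × X => L p.1 p.2) ∧
      ∀ τ x, 0 ≤ L τ x ∧ W (L τ x) x = max τ c := by
  have hex : ∀ τ x, ∃ l, 0 ≤ l ∧ W l x = max τ c := by
    intro τ x
    obtain ⟨b, hb, hb0⟩ := (((ht x).eventually_ge_atTop (max τ c)).and
      (Filter.eventually_ge_atTop 0)).exists
    have hc : Continuous fun l => W l x := hW.comp (by fun_prop : Continuous fun l : ℝ => (l, x))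
    obtain ⟨l, hl, hl'⟩ := intermediate_value_Icc hb0 hc.continuousOn
      (show max τ c ∈ Set.Icc (W 0 x) (W b x) from ⟨by rw [h0]; exact le_max_right _ _, hb⟩)
    exact ⟨l, hl.1, hl'⟩
  choose L hL0 hL using hex
  refine ⟨L, ?_, fun τ x => ⟨hL0 τ x, hL τ x⟩⟩
  have hWa : ∀ a : ℝ, Continuous fun p : ℝ × X => W a p.2 := fun a =>
    hW.comp (by fun_prop : Continuous fun p : ℝ × X => (a, p.2))
  have hmax : Continuous fun p : ℝ × X => max p.1 c := by fun_prop
  rw [OrderTopology.continuous_iff]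
  intro a
  constructor
  · rcases lt_or_ge a 0 with ha | ha
    · convert isOpen_univ
      exact Set.eq_univ_of_forall fun p => ha.trans_le (hL0 p.1 p.2)
    · convert isOpen_lt (hWa a) hmax using 1
      ext p
      simp only [Set.mem_preimage, Set.mem_Ioi, Set.mem_ofPred_eq]
      rw [← hL p.1 p.2]
      exact ((hm p.2).lt_iff_lt ha (hL0 _ _)).symm
  · rcases le_or_gt a 0 with ha | ha
    · convert isOpen_empty
      exact Set.eq_empty_of_forall_notMem fun p hp => (hL0 p.1 p.2).not_gt (lt_of_lt_of_le hp ha)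
    · convert isOpen_lt hmax (hWa a) using 1
      ext p
      simp only [Set.mem_preimage, Set.mem_Iio, Set.mem_ofPred_eq]
      rw [← hL p.1 p.2]
      exact ((hm p.2).lt_iff_lt (hL0 _ _) ha.le).symm

section CenterFlow

variable {ι : Type*} [Fintype ι] {γ : ℝ → EuclideanSpace ℝ ι}

lemma continuous_confLength (hγ : ContDiff ℝ 1 γ) :
    Continuous fun p : ℝ × ℝ => confLength γ p.1 p.2 := by
  have hcγ := hγ.continuous
  have hcd : Continuous (deriv γ) := hγ.continuous_deriv le_rfl
  unfold confLength
  exact intervalIntegral.continuous_parametric_intervalIntegral_of_continuous' (by fun_prop) _ _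

lemma continuous_confSqLength (hγ : ContDiff ℝ 1 γ) :
    Continuous fun p : ℝ × ℝ => confSqLength γ p.1 p.2 := by
  have hcγ := hγ.continuous
  have hcd : Continuous (deriv γ) := hγ.continuous_deriv le_rfl
  unfold confSqLength
  exact intervalIntegral.continuous_parametric_intervalIntegral_of_continuous' (by fun_prop) _ _

lemma continuous_confConc (hγ : ContDiff ℝ 1 γ) (hP : Function.Periodic γ (2 * π))
    {c : ℝ} (hc : deriv γ c ≠ 0) : Continuous fun p : ℝ × ℝ => confConc γ p.1 p.2 :=
  (continuous_confSqLength hγ).div ((continuous_confLength hγ).pow 2)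
    fun p => pow_ne_zero 2 (confLength_pos hγ hP hc p.1 p.2).ne'

lemma continuous_confCenter (hγ : ContDiff ℝ 1 γ) (hP : Function.Periodic γ (2 * π))
    {c : ℝ} (hc : deriv γ c ≠ 0) : Continuous fun p : ℝ × ℝ => confCenter γ p.1 p.2 := by
  have hcγ := hγ.continuous
  have hcd : Continuous (deriv γ) := hγ.continuous_deriv le_rfl
  unfold confCenter
  refine (PiLp.continuous_toLp 2 _).comp (continuous_pi fun i => ?_)
  refine Continuous.div ?_ (continuous_confSqLength hγ)
    fun p => (confSqLength_pos hγ hP hc p.1 p.2).ne'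
  exact intervalIntegral.continuous_parametric_intervalIntegral_of_continuous' (by fun_prop) _ _

lemma confWeight_zero (γ : ℝ → EuclideanSpace ℝ ι) (u s : ℝ) : confWeight γ 0 u s = 1 := by
  simp [confWeight]

lemma confLength_zero (γ : ℝ → EuclideanSpace ℝ ι) (u : ℝ) :
    confLength γ 0 u = ∫ s in (0 : ℝ)..(2 * π), ‖deriv γ s‖ := by
  simp [confLength, confWeight_zero]

lemma confConc_zero (γ : ℝ → EuclideanSpace ℝ ι) (u : ℝ) :
    confConc γ 0 u = 1 / ∫ s in (0 : ℝ)..(2 * π), ‖deriv γ s‖ := by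
  simp only [confConc, confSqLength, confLength_zero, confWeight_zero, one_pow, one_mul]
  rw [sq, div_mul_eq_div_div]
  rcases eq_or_ne (∫ s in (0 : ℝ)..(2 * π), ‖deriv γ s‖) 0 with h | h
  · simp [h]
  · rw [div_self h]

lemma confCenter_zero (γ : ℝ → EuclideanSpace ℝ ι) (u v : ℝ) :
    confCenter γ 0 u = confCenter γ 0 v := by
  simp only [confCenter, confSqLength, confWeight_zero]

lemma confConc_add_moment (hγ : ContDiff ℝ 1 γ) (hP : Function.Periodic γ (2 * π))
    {c : ℝ} (hc : deriv γ c ≠ 0) (l u : ℝ) :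
    confConc γ l u + l ^ 2 * confMoment γ l u (γ u) = 1 / confLength γ l u := by
  have hcγ := hγ.continuous
  have hcd : Continuous (deriv γ) := hγ.continuous_deriv le_rfl
  have hJ := confLength_pos hγ hP hc l u
  rw [confConc, confSqLength, confMoment, ← intervalIntegral.integral_div,
      ← intervalIntegral.integral_const_mul, ← intervalIntegral.integral_add
      (Continuous.intervalIntegrable (by fun_prop) _ _)
      (Continuous.intervalIntegrable (by fun_prop) _ _)]
  have h1 : 1 / confLength γ l u
      = (∫ s in (0 : ℝ)..(2 * π), confWeight γ l u s * ‖deriv γ s‖) / confLength γ l u ^ 2 := by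
    change _ = confLength γ l u / _
    field_simp
  rw [h1, ← intervalIntegral.integral_div]
  congr 1
  ext s
  linear_combination (confWeight γ l u s * ‖deriv γ s‖ / confLength γ l u ^ 2)
    * confWeight_mul γ l u s

/-- The barycentre lies near the base point when the density is concentrated. -/
lemma norm_confCenter_sub_le (hγ : ContDiff ℝ 1 γ) (hP : Function.Periodic γ (2 * π))
    {c : ℝ} (hc : deriv γ c ≠ 0) {D : ℝ} (hD0 : 0 < D) (hD : ∀ s u, ‖γ s - γ u‖ ≤ D) {l u : ℝ}
    (hw : 2 / (∫ s in (0 : ℝ)..(2 * π), ‖deriv γ s‖) ≤ confConc γ l u) :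
    ‖confCenter γ l u - γ u‖ ^ 2
      ≤ 2 * D ^ 2 / ((∫ s in (0 : ℝ)..(2 * π), ‖deriv γ s‖) * confConc γ l u) := by
  have hcγ := hγ.continuous
  have hcd : Continuous (deriv γ) := hγ.continuous_deriv le_rfl
  have hℓ := confLength_pos hγ hP hc 0 0
  rw [confLength_zero] at hℓ
  set ℓ := ∫ s in (0 : ℝ)..(2 * π), ‖deriv γ s‖ with hℓdef
  have hJ := confLength_pos hγ hP hc l u
  have h1 := confConc_add_moment hγ hP hc l u
  have h2 := confMoment_eq_add hγ hP hc l u (γ u)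
  have h3 : ∀ p, 0 ≤ confMoment γ l u p := fun p =>
    intervalIntegral.integral_nonneg (by positivity) fun s _ => by positivity
  have hw0 : 0 < confConc γ l u := lt_of_lt_of_le (by positivity) hw
  have h4 : ℓ ≤ confLength γ l u * (1 + l ^ 2 * D ^ 2) := by
    rw [hℓdef, confLength, ← intervalIntegral.integral_mul_const]
    refine intervalIntegral.integral_mono_on (by positivity)
      (Continuous.intervalIntegrable (by fun_prop) _ _)
      (Continuous.intervalIntegrable (by fun_prop) _ _) fun s _ => ?_
    have h5 : 1 ≤ confWeight γ l u s * (1 + l ^ 2 * D ^ 2) := by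
      have := (confWeight_pos γ l u s).le
      have := hD s u
      calc 1 = confWeight γ l u s * (1 + l ^ 2 * ‖γ s - γ u‖ ^ 2) := (confWeight_mul γ l u s).symm
        _ ≤ _ := by gcongr
    nlinarith [norm_nonneg (deriv γ s)]
  set w := confConc γ l u
  set q := confMoment γ l u (γ u)
  set J := confLength γ l u
  set n := ‖confCenter γ l u - γ u‖ ^ 2
  have hn : 0 ≤ n := by positivity
  have hq : w * n ≤ q := by linarith [h3 (confCenter γ l u)]
  have h5 : w ≤ 1 / J := by nlinarith [h3 (γ u), sq_nonneg l]
  have h6 : l ^ 2 * (w * n) ≤ 1 / J := by nlinarith [sq_nonneg l]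
  have h7 : 2 * J ≤ ℓ := by
    have := hw.trans h5
    rw [div_le_div_iff₀ hℓ hJ] at this
    linarith
  have h8 : 1 ≤ l ^ 2 * D ^ 2 := by
    by_contra! h
    nlinarith
  have h9 : ℓ ≤ 2 * D ^ 2 * (l ^ 2 * J) := by nlinarith
  rw [le_div_iff₀ hJ] at h6
  rw [le_div_iff₀ (by positivity)]
  calc n * (ℓ * w) = ℓ * (w * n) := by ring
    _ ≤ 2 * D ^ 2 * (l ^ 2 * J) * (w * n) := by gcongr
    _ = 2 * D ^ 2 * (l ^ 2 * (w * n) * J) := by ring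
    _ ≤ 2 * D ^ 2 * 1 := by gcongr
    _ = _ := mul_one _

/-- A homotopy from a closed curve to a point through the barycentres of concentration `τ`. -/
lemma exists_center_homotopy (hγ : ContDiff ℝ 1 γ) (hP : Function.Periodic γ (2 * π))
    {c : ℝ} (hc : deriv γ c ≠ 0) :
    ∃ (m : ℝ → ℝ → EuclideanSpace ℝ ι) (τ₀ : ℝ), Continuous (fun p : ℝ × ℝ => m p.1 p.2) ∧
      (∀ τ, Function.Periodic (m τ) (2 * π)) ∧ (∀ u v, m τ₀ u = m τ₀ v) ∧
      (∀ τ u, τ₀ ≤ τ → ∃ l, m τ u = confCenter γ l u ∧ confConc γ l u = τ) ∧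
      (∀ ε > 0, ∃ T, ∀ τ ≥ T, ∀ u, ‖m τ u - γ u‖ < ε) := by
  have hℓ := confLength_pos hγ hP hc 0 0
  rw [confLength_zero] at hℓ
  have hmono := confConc_strictMonoOn hγ hP hc
  obtain ⟨D, hD0, hD⟩ := exists_norm_sub_le hγ.continuous hP
  set ℓ := ∫ s in (0 : ℝ)..(2 * π), ‖deriv γ s‖ with hℓdef
  obtain ⟨L, hLc, hL⟩ : ∃ L : ℝ → ℝ → ℝ, Continuous (fun p : ℝ × ℝ => L p.1 p.2) ∧
      ∀ τ u, 0 ≤ L τ u ∧ confConc γ (L τ u) u = max τ (1 / ℓ) :=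
    exists_continuous_inverse (W := fun l u => confConc γ l u) (continuous_confConc hγ hP hc)
      (confConc_zero γ) hmono (tendsto_confConc_atTop hγ hP hc)
  have hinj : ∀ {l l' u : ℝ}, 0 ≤ l → 0 ≤ l' → confConc γ l u = confConc γ l' u → l = l' :=
    fun {l l' u} hl hl' h => (hmono u).injOn hl hl' h
  have hwP : ∀ l s u, confWeight γ l (u + 2 * π) s = confWeight γ l u s := by
    intro l s u; simp only [confWeight, hP u]
  have hconcP : ∀ l u, confConc γ l (u + 2 * π) = confConc γ l u := by
    intro l u; simp only [confConc, confSqLength, confLength, hwP]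
  have hLP : ∀ τ u, L τ (u + 2 * π) = L τ u := by
    intro τ u
    exact hinj (u := u) (hL τ _).1 (hL τ u).1
      ((hconcP _ u).symm.trans ((hL τ (u + 2 * π)).2.trans (hL τ u).2.symm))
  refine ⟨fun τ u => confCenter γ (L τ u) u, 1 / ℓ, ?_, ?_, ?_, ?_, ?_⟩
  · have h1 : Continuous fun p : ℝ × ℝ => (L p.1 p.2, p.2) := hLc.prodMk continuous_snd
    have h2 := (continuous_confCenter hγ hP hc).comp h1
    exact h2
  · intro τ u
    simp only [hLP, confCenter, confSqLength, hwP]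
  · have h0 : ∀ u, L (1 / ℓ) u = 0 := by
      intro u
      refine hinj (u := u) (hL _ u).1 le_rfl ?_
      rw [(hL _ u).2, confConc_zero, max_self]
    intro u v
    simp only [h0]
    exact confCenter_zero γ u v
  · intro τ u hτ
    exact ⟨L τ u, rfl, by rw [(hL τ u).2, max_eq_left hτ]⟩
  · intro ε hε
    refine ⟨max (2 / ℓ) (2 * D ^ 2 / (ℓ * ε ^ 2) + 1), fun τ hτ u => ?_⟩
    have h1 : 2 / ℓ ≤ τ := (le_max_left _ _).trans hτ
    have h2 : 2 * D ^ 2 / (ℓ * ε ^ 2) < τ := by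
      have := (le_max_right _ _).trans hτ
      linarith
    have h3 : confConc γ (L τ u) u = τ := by
      rw [(hL τ u).2, max_eq_left]
      refine le_trans ?_ h1
      gcongr
      norm_num
    have h4 := norm_confCenter_sub_le hγ hP hc hD0 hD (l := L τ u) (u := u) (by rw [h3]; exact h1)
    rw [h3] at h4
    have hτ0 : 0 < τ := lt_of_lt_of_le (by positivity) h1
    refine lt_of_pow_lt_pow_left₀ 2 hε.le (h4.trans_lt ?_)
    rw [div_lt_iff₀ (by positivity)] at h2 ⊢
    linarith

end CenterFlow

lemma det3_eq (a b c : EuclideanSpace ℝ (Fin 3)) : det3 a b c =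
    a 0 * b 1 * c 2 - a 0 * c 1 * b 2 - b 0 * a 1 * c 2 + b 0 * c 1 * a 2 + c 0 * a 1 * b 2
      - c 0 * b 1 * a 2 := by
  simp [det3, Matrix.det_fin_three]

@[fun_prop]
lemma Continuous.det3 {X : Type*} [TopologicalSpace X] {u v w : X → EuclideanSpace ℝ (Fin 3)}
    (hu : Continuous u) (hv : Continuous v) (hw : Continuous w) :
    Continuous fun x => det3 (u x) (v x) (w x) := by
  simp only [det3_eq]
  fun_prop

lemma hasDerivAt_coord {ι : Type*} [Fintype ι] {u : ℝ → EuclideanSpace ℝ ι}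
    {u' : EuclideanSpace ℝ ι} {x : ℝ} (hu : HasDerivAt u u' x) (i : ι) :
    HasDerivAt (fun x => u x i) (u' i) x :=
  ((EuclideanSpace.proj i : EuclideanSpace ℝ ι →L[ℝ] ℝ).hasFDerivAt.comp_hasDerivAt x hu)

lemma hasDerivAt_det3 {u v w : ℝ → EuclideanSpace ℝ (Fin 3)} {u' v' w' : EuclideanSpace ℝ (Fin 3)}
    {x : ℝ} (hu : HasDerivAt u u' x) (hv : HasDerivAt v v' x) (hw : HasDerivAt w w' x) :
    HasDerivAt (fun x => det3 (u x) (v x) (w x))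
      (det3 u' (v x) (w x) + det3 (u x) v' (w x) + det3 (u x) (v x) w') x := by
  have hu := hasDerivAt_coord hu
  have hv := hasDerivAt_coord hv
  have hw := hasDerivAt_coord hw
  simp only [det3_eq]
  refine HasDerivAt.congr_deriv ((((((((hu 0).mul (hv 1)).mul (hw 2)).sub (((hu 0).mul (hw 1)).mul (hv 2))).sub
    (((hv 0).mul (hu 1)).mul (hw 2))).add (((hv 0).mul (hw 1)).mul (hu 2))).add
    (((hw 0).mul (hu 1)).mul (hv 2))).sub (((hw 0).mul (hv 1)).mul (hu 2))) ?_
  simp only [Pi.mul_apply]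
  ring

lemma hasDerivAt_norm_pow_three {E : Type*} [NormedAddCommGroup E] [InnerProductSpace ℝ E]
    {w : ℝ → E} {w' : E} {x : ℝ} (hw : HasDerivAt w w' x) (h0 : w x ≠ 0) :
    HasDerivAt (fun x => ‖w x‖ ^ 3) (3 * ‖w x‖ * inner ℝ (w x) w') x := by
  have hn : 0 < ‖w x‖ := norm_pos_iff.mpr h0
  have h := hw.norm_sq.sqrt (by positivity)
  simp only [Real.sqrt_sq (norm_nonneg _)] at h
  refine (h.pow 3).congr_deriv ?_
  field_simp
  norm_num
  ring

/-- The derivative of the Gauss integrand. -/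
lemma hasDerivAt_det3_div_norm_pow_three {u v w : ℝ → EuclideanSpace ℝ (Fin 3)}
    {u' v' w' : EuclideanSpace ℝ (Fin 3)} {x : ℝ} (hu : HasDerivAt u u' x)
    (hv : HasDerivAt v v' x) (hw : HasDerivAt w w' x) (h0 : w x ≠ 0) :
    HasDerivAt (fun x => det3 (u x) (v x) (w x) / ‖w x‖ ^ 3)
      ((det3 u' (v x) (w x) + det3 (u x) v' (w x) + det3 (u x) (v x) w') / ‖w x‖ ^ 3
        - 3 * inner ℝ (w x) w' * det3 (u x) (v x) (w x) / ‖w x‖ ^ 5) x := by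
  have hn : 0 < ‖w x‖ := norm_pos_iff.mpr h0
  refine ((hasDerivAt_det3 hu hv hw).div (hasDerivAt_norm_pow_three hw h0)
    (by positivity)).congr_deriv ?_
  field_simp

/-- A scalar integrand over the torus that moves by a divergence has constant integral. -/
lemma integral_integral_eq_of_hasDerivAt {f P Q A B : ℝ → ℝ → ℝ → ℝ}
    (hA : Continuous fun p : ℝ × ℝ × ℝ => A p.1 p.2.1 p.2.2)
    (hB : Continuous fun p : ℝ × ℝ × ℝ => B p.1 p.2.1 p.2.2)
    (hf : Continuous fun p : ℝ × ℝ × ℝ => f p.1 p.2.1 p.2.2)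
    (hdf : ∀ σ s t, HasDerivAt (fun σ => f σ s t) (A σ s t + B σ s t) σ)
    (hdP : ∀ σ s t, HasDerivAt (fun s => P σ s t) (A σ s t) s)
    (hdQ : ∀ σ s t, HasDerivAt (fun t => Q σ s t) (B σ s t) t)
    {T : ℝ} (hP : ∀ σ t, P σ T t = P σ 0 t) (hQ : ∀ σ s, Q σ s T = Q σ s 0) (σ₀ σ₁ : ℝ) :
    ∫ s in (0 : ℝ)..T, ∫ t in (0 : ℝ)..T, f σ₁ s t
      = ∫ s in (0 : ℝ)..T, ∫ t in (0 : ℝ)..T, f σ₀ s t := by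
  have comp3 : ∀ {X : Type} [TopologicalSpace X] {g : ℝ → ℝ → ℝ → ℝ}
      (_ : Continuous fun p : ℝ × ℝ × ℝ => g p.1 p.2.1 p.2.2) {a b c : X → ℝ} (_ : Continuous a)
      (_ : Continuous b) (_ : Continuous c), Continuous fun x => g (a x) (b x) (c x) :=
    fun hg _ _ _ ha hb hc => hg.comp (ha.prodMk (hb.prodMk hc))
  have swap : ∀ {g : ℝ → ℝ → ℝ} (_ : Continuous fun p : ℝ × ℝ => g p.1 p.2) (a b c d : ℝ),
      ∫ x in a..b, ∫ y in c..d, g x y = ∫ y in c..d, ∫ x in a..b, g x y := by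
    intro g hg a b c d
    refine intervalIntegral_intervalIntegral_swap ?_
    exact (hg.continuousOn.integrableOn_compact (isCompact_uIcc.prod isCompact_uIcc)).mono_set
      (Set.prod_mono Set.uIoc_subset_uIcc Set.uIoc_subset_uIcc)
  have par : ∀ {X : Type} [TopologicalSpace X] {g : X → ℝ → ℝ}
      (_ : Continuous fun p : X × ℝ => g p.1 p.2) (a b : ℝ),
      Continuous fun x => ∫ y in a..b, g x y := fun hg a b =>
    intervalIntegral.continuous_parametric_intervalIntegral_of_continuous' hg a b
  have key : ∀ s t, f σ₁ s t - f σ₀ s t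
      = (∫ σ in σ₀..σ₁, A σ s t) + ∫ σ in σ₀..σ₁, B σ s t := by
    intro s t
    have cA : Continuous fun σ => A σ s t := comp3 hA (by fun_prop) (by fun_prop) (by fun_prop)
    have cB : Continuous fun σ => B σ s t := comp3 hB (by fun_prop) (by fun_prop) (by fun_prop)
    rw [← intervalIntegral.integral_add (cA.intervalIntegrable _ _) (cB.intervalIntegrable _ _),
      intervalIntegral.integral_eq_sub_of_hasDerivAt (fun σ _ => hdf σ s t)
        ((cA.add cB).intervalIntegrable _ _)]
  have cf : ∀ σ, Continuous fun p : ℝ × ℝ => f σ p.1 p.2 := fun σ =>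
    comp3 hf (by fun_prop) (by fun_prop) (by fun_prop)
  have cIA : Continuous fun p : ℝ × ℝ => ∫ σ in σ₀..σ₁, A σ p.1 p.2 :=
    par (comp3 (X := (ℝ × ℝ) × ℝ) hA (a := fun p => p.2) (by fun_prop) (by fun_prop) (by fun_prop))
      _ _
  have cIB : Continuous fun p : ℝ × ℝ => ∫ σ in σ₀..σ₁, B σ p.1 p.2 :=
    par (comp3 (X := (ℝ × ℝ) × ℝ) hB (a := fun p => p.2) (by fun_prop) (by fun_prop) (by fun_prop))
      _ _
  have slice : ∀ {g : ℝ → ℝ → ℝ} (_ : Continuous fun p : ℝ × ℝ => g p.1 p.2) (s : ℝ),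
      IntervalIntegrable (fun t => g s t) volume 0 T := fun hg s =>
    (hg.comp (by fun_prop : Continuous fun t : ℝ => (s, t))).intervalIntegrable _ _
  have zA : ∫ s in (0 : ℝ)..T, ∫ t in (0 : ℝ)..T, ∫ σ in σ₀..σ₁, A σ s t = 0 := by
    rw [swap cIA]
    refine intervalIntegral.integral_zero_ae (.of_forall fun t _ => ?_)
    rw [swap (g := fun s σ => A σ s t) (comp3 hA (by fun_prop) (by fun_prop) (by fun_prop))]
    refine intervalIntegral.integral_zero_ae (.of_forall fun σ _ => ?_)
    rw [intervalIntegral.integral_eq_sub_of_hasDerivAt (fun s _ => hdP σ s t)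
      ((comp3 hA (by fun_prop) (by fun_prop) (by fun_prop) :
        Continuous fun s => A σ s t).intervalIntegrable _ _), hP, sub_self]
  have zB : ∫ s in (0 : ℝ)..T, ∫ t in (0 : ℝ)..T, ∫ σ in σ₀..σ₁, B σ s t = 0 := by
    refine intervalIntegral.integral_zero_ae (.of_forall fun s _ => ?_)
    rw [swap (g := fun t σ => B σ s t) (comp3 hB (by fun_prop) (by fun_prop) (by fun_prop))]
    refine intervalIntegral.integral_zero_ae (.of_forall fun σ _ => ?_)
    rw [intervalIntegral.integral_eq_sub_of_hasDerivAt (fun t _ => hdQ σ s t)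
      ((comp3 hB (by fun_prop) (by fun_prop) (by fun_prop) :
        Continuous fun t => B σ s t).intervalIntegrable _ _), hQ, sub_self]
  rw [← sub_eq_zero, ← intervalIntegral.integral_sub ((par (cf σ₁) _ _).intervalIntegrable _ _)
    ((par (cf σ₀) _ _).intervalIntegrable _ _)]
  have : ∀ s, (∫ t in (0 : ℝ)..T, f σ₁ s t) - (∫ t in (0 : ℝ)..T, f σ₀ s t)
      = (∫ t in (0 : ℝ)..T, ∫ σ in σ₀..σ₁, A σ s t)
        + ∫ t in (0 : ℝ)..T, ∫ σ in σ₀..σ₁, B σ s t := by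
    intro s
    rw [← intervalIntegral.integral_sub (slice (cf σ₁) s) (slice (cf σ₀) s),
      ← intervalIntegral.integral_add (slice (g := fun s t => ∫ σ in σ₀..σ₁, A σ s t) cIA s)
        (slice (g := fun s t => ∫ σ in σ₀..σ₁, B σ s t) cIB s)]
    simp only [key]
  simp only [this]
  rw [intervalIntegral.integral_add ((par cIA _ _).intervalIntegrable _ _)
    ((par cIB _ _).intervalIntegrable _ _), zA, zB, add_zero]

/-- The Gauss integral does not change under a regular homotopy through disjoint curves. -/
lemma gauss_integral_eq_of_hasDerivAt {a b p q g h p' q' : ℝ → ℝ → EuclideanSpace ℝ (Fin 3)}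
    {T : ℝ} (hp : ∀ σ s, HasDerivAt (a σ) (p σ s) s) (hq : ∀ σ t, HasDerivAt (b σ) (q σ t) t)
    (hg : ∀ σ s, HasDerivAt (fun σ => a σ s) (g σ s) σ)
    (hh : ∀ σ t, HasDerivAt (fun σ => b σ t) (h σ t) σ)
    (hpσ : ∀ σ s, HasDerivAt (fun σ => p σ s) (p' σ s) σ)
    (hqσ : ∀ σ t, HasDerivAt (fun σ => q σ t) (q' σ t) σ)
    (hgs : ∀ σ s, HasDerivAt (g σ) (p' σ s) s) (hht : ∀ σ t, HasDerivAt (h σ) (q' σ t) t)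
    (ca : Continuous (Function.uncurry a)) (cb : Continuous (Function.uncurry b))
    (cp : Continuous (Function.uncurry p)) (cq : Continuous (Function.uncurry q))
    (cg : Continuous (Function.uncurry g)) (ch : Continuous (Function.uncurry h))
    (cp' : Continuous (Function.uncurry p')) (cq' : Continuous (Function.uncurry q'))
    (haT : ∀ σ, a σ T = a σ 0) (hbT : ∀ σ, b σ T = b σ 0) (hgT : ∀ σ, g σ T = g σ 0)
    (hhT : ∀ σ, h σ T = h σ 0) (hne : ∀ σ s t, a σ s ≠ b σ t) (σ₀ σ₁ : ℝ) :
    ∫ s in (0 : ℝ)..T, ∫ t in (0 : ℝ)..T,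
        det3 (p σ₁ s) (q σ₁ t) (a σ₁ s - b σ₁ t) / ‖a σ₁ s - b σ₁ t‖ ^ 3
      = ∫ s in (0 : ℝ)..T, ∫ t in (0 : ℝ)..T,
        det3 (p σ₀ s) (q σ₀ t) (a σ₀ s - b σ₀ t) / ‖a σ₀ s - b σ₀ t‖ ^ 3 := by
  have h0 : ∀ σ s t, a σ s - b σ t ≠ 0 := fun σ s t => sub_ne_zero.mpr (hne σ s t)
  have hn : ∀ σ s t, 0 < ‖a σ s - b σ t‖ := fun σ s t => norm_pos_iff.mpr (h0 σ s t)
  have c1 : ∀ {k : ℝ → ℝ → EuclideanSpace ℝ (Fin 3)}, Continuous (Function.uncurry k) →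
      Continuous fun x : ℝ × ℝ × ℝ => k x.1 x.2.1 := fun hk =>
    hk.comp (by fun_prop : Continuous fun x : ℝ × ℝ × ℝ => (x.1, x.2.1))
  have c2 : ∀ {k : ℝ → ℝ → EuclideanSpace ℝ (Fin 3)}, Continuous (Function.uncurry k) →
      Continuous fun x : ℝ × ℝ × ℝ => k x.1 x.2.2 := fun hk =>
    hk.comp (by fun_prop : Continuous fun x : ℝ × ℝ × ℝ => (x.1, x.2.2))
  have ca := c1 ca
  have cb := c2 cb
  have cp := c1 cp
  have cq := c2 cq
  have cg := c1 cg
  have ch := c2 ch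
  have cp' := c1 cp'
  have cq' := c2 cq'
  refine integral_integral_eq_of_hasDerivAt
    (f := fun σ s t => det3 (p σ s) (q σ t) (a σ s - b σ t) / ‖a σ s - b σ t‖ ^ 3)
    (P := fun σ s t => det3 (g σ s - h σ t) (q σ t) (a σ s - b σ t) / ‖a σ s - b σ t‖ ^ 3)
    (Q := fun σ s t => -(det3 (p σ s) (g σ s - h σ t) (a σ s - b σ t) / ‖a σ s - b σ t‖ ^ 3))
    (A := fun σ s t => (det3 (p' σ s) (q σ t) (a σ s - b σ t)
        + det3 (g σ s - h σ t) (q σ t) (p σ s)) / ‖a σ s - b σ t‖ ^ 3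
      - 3 * inner ℝ (a σ s - b σ t) (p σ s) * det3 (g σ s - h σ t) (q σ t) (a σ s - b σ t)
        / ‖a σ s - b σ t‖ ^ 5)
    (B := fun σ s t => (det3 (p σ s) (q' σ t) (a σ s - b σ t)
        + det3 (p σ s) (g σ s - h σ t) (q σ t)) / ‖a σ s - b σ t‖ ^ 3
      - 3 * inner ℝ (a σ s - b σ t) (q σ t) * det3 (p σ s) (g σ s - h σ t) (a σ s - b σ t)
        / ‖a σ s - b σ t‖ ^ 5) ?_ ?_ ?_ ?_ ?_ ?_ ?_ ?_ σ₀ σ₁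
  · exact ((by fun_prop : Continuous _).div (by fun_prop) fun x => (pow_pos (hn _ _ _) 3).ne').sub
      ((by fun_prop : Continuous _).div (by fun_prop) fun x => (pow_pos (hn _ _ _) 5).ne')
  · exact ((by fun_prop : Continuous _).div (by fun_prop) fun x => (pow_pos (hn _ _ _) 3).ne').sub
      ((by fun_prop : Continuous _).div (by fun_prop) fun x => (pow_pos (hn _ _ _) 5).ne')
  · exact (by fun_prop : Continuous _).div (by fun_prop) fun x => (pow_pos (hn _ _ _) 3).ne'
  · intro σ s t
    have hd := hasDerivAt_det3_div_norm_pow_three (hpσ σ s) (hqσ σ t) ((hg σ s).sub (hh σ t)) (h0 σ s t)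
    refine hd.congr_deriv ?_
    have hN := EuclideanSpace.real_norm_sq_eq (a σ s - b σ t)
    simp only [Pi.sub_apply]
    have hnn := hn σ s t
    generalize a σ s - b σ t = w at *
    generalize g σ s - h σ t = r
    have hdet : 3 * det3 (p σ s) (q σ t) r * ‖w‖ ^ 2
        = 3 * inner ℝ w r * det3 (p σ s) (q σ t) w - 3 * inner ℝ w (p σ s) * det3 r (q σ t) w
          - 3 * inner ℝ w (q σ t) * det3 (p σ s) r w := by
      rw [hN]
      simp only [det3_eq, PiLp.inner_apply, Fin.sum_univ_three, RCLike.inner_apply, conj_trivial]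
      ring
    have hsym : det3 r (q σ t) (p σ s) = -det3 (p σ s) (q σ t) r ∧
        det3 (p σ s) r (q σ t) = -det3 (p σ s) (q σ t) r := by
      simp only [det3_eq]
      constructor <;> ring
    rw [hsym.1, hsym.2]
    field_simp
    linear_combination hdet
  · intro σ s t
    have hd := hasDerivAt_det3_div_norm_pow_three ((hgs σ s).sub_const (h σ t))
      (hasDerivAt_const s (q σ t)) ((hp σ s).sub_const (b σ t)) (h0 σ s t)
    refine hd.congr_deriv ?_
    congr 2
    simp [det3_eq]
  · intro σ s t
    have hd := (hasDerivAt_det3_div_norm_pow_three (hasDerivAt_const t (p σ s))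
      ((hht σ t).const_sub (g σ s)) ((hq σ t).const_sub (a σ s)) (h0 σ s t)).neg
    refine hd.congr_deriv ?_
    simp only [inner_neg_right, det3_eq, PiLp.neg_apply, PiLp.zero_apply]
    ring
  · intro σ t
    simp only [haT, hgT]
  · intro σ s
    simp only [hbT, hhT]

/-- The linking integral does not change along a straight-line homotopy through disjoint curves. -/
lemma gaussLinking_eq_of_segment {a₀ a₁ b₀ b₁ : ℝ → EuclideanSpace ℝ (Fin 3)}
    (ha₀ : ContDiff ℝ 1 a₀) (ha₁ : ContDiff ℝ 1 a₁) (hb₀ : ContDiff ℝ 1 b₀)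
    (hb₁ : ContDiff ℝ 1 b₁) (hPa₀ : Function.Periodic a₀ (2 * π))
    (hPa₁ : Function.Periodic a₁ (2 * π)) (hPb₀ : Function.Periodic b₀ (2 * π))
    (hPb₁ : Function.Periodic b₁ (2 * π))
    (hne : ∀ x y : ℝ, 0 ≤ x → 0 ≤ y → x + y = 1 → ∀ s t,
      x • a₀ s + y • a₁ s ≠ x • b₀ t + y • b₁ t) :
    gaussLinking a₀ b₀ = gaussLinking a₁ b₁ := by
  have d : ∀ {k : ℝ → EuclideanSpace ℝ (Fin 3)}, ContDiff ℝ 1 k → ∀ s,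
      HasDerivAt k (deriv k s) s := fun hk s => (hk.differentiable one_ne_zero s).hasDerivAt
  have cd : ∀ {k : ℝ → EuclideanSpace ℝ (Fin 3)}, ContDiff ℝ 1 k → Continuous (deriv k) :=
    fun hk => hk.continuous_deriv le_rfl
  have ca₀ := ha₀.continuous
  have ca₁ := ha₁.continuous
  have cb₀ := hb₀.continuous
  have cb₁ := hb₁.continuous
  have da₀ := cd ha₀
  have da₁ := cd ha₁
  have db₀ := cd hb₀
  have db₁ := cd hb₁
  have hcos : ∀ σ : ℝ, HasDerivAt (fun σ => cos σ ^ 2) (-(2 * sin σ * cos σ)) σ := fun σ =>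
    ((hasDerivAt_cos σ).pow 2).congr_deriv (by push_cast; ring)
  have hsin : ∀ σ : ℝ, HasDerivAt (fun σ => sin σ ^ 2) (2 * sin σ * cos σ) σ := fun σ =>
    ((hasDerivAt_sin σ).pow 2).congr_deriv (by push_cast; ring)
  have hmix : ∀ (u v : EuclideanSpace ℝ (Fin 3)) (σ : ℝ),
      HasDerivAt (fun σ => cos σ ^ 2 • u + sin σ ^ 2 • v) ((2 * sin σ * cos σ) • (v - u)) σ :=
    fun u v σ => (((hcos σ).smul_const u).add ((hsin σ).smul_const v)).congr_deriv (by module)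
  have hT : ∀ {k : ℝ → EuclideanSpace ℝ (Fin 3)}, Function.Periodic k (2 * π) →
      k (2 * π) = k 0 := fun hk => by simpa using hk 0
  have hlin : ∀ {u v : ℝ → EuclideanSpace ℝ (Fin 3)}, ContDiff ℝ 1 u → ContDiff ℝ 1 v →
      ∀ x y s : ℝ, HasDerivAt (fun s => x • u s + y • v s) (x • deriv u s + y • deriv v s) s :=
    fun hu hv x y s => ((d hu s).fun_const_smul x).fun_add ((d hv s).fun_const_smul y)
  have hsub : ∀ {u v : ℝ → EuclideanSpace ℝ (Fin 3)}, ContDiff ℝ 1 u → ContDiff ℝ 1 v →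
      ∀ x s : ℝ, HasDerivAt (fun s => x • (v s - u s)) (x • (deriv v s - deriv u s)) s :=
    fun hu hv x s => ((d hv s).fun_sub (d hu s)).fun_const_smul x
  have key := gauss_integral_eq_of_hasDerivAt (T := 2 * π)
    (a := fun σ s => cos σ ^ 2 • a₀ s + sin σ ^ 2 • a₁ s)
    (b := fun σ t => cos σ ^ 2 • b₀ t + sin σ ^ 2 • b₁ t)
    (p := fun σ s => cos σ ^ 2 • deriv a₀ s + sin σ ^ 2 • deriv a₁ s)
    (q := fun σ t => cos σ ^ 2 • deriv b₀ t + sin σ ^ 2 • deriv b₁ t)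
    (g := fun σ s => (2 * sin σ * cos σ) • (a₁ s - a₀ s))
    (h := fun σ t => (2 * sin σ * cos σ) • (b₁ t - b₀ t))
    (p' := fun σ s => (2 * sin σ * cos σ) • (deriv a₁ s - deriv a₀ s))
    (q' := fun σ t => (2 * sin σ * cos σ) • (deriv b₁ t - deriv b₀ t))
    (fun σ s => hlin ha₀ ha₁ _ _ s) (fun σ t => hlin hb₀ hb₁ _ _ t)
    (fun σ s => hmix _ _ σ) (fun σ t => hmix _ _ σ) (fun σ s => hmix _ _ σ)
    (fun σ t => hmix _ _ σ) (fun σ s => hsub ha₀ ha₁ _ s) (fun σ t => hsub hb₀ hb₁ _ t)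
    (by fun_prop) (by fun_prop) (by fun_prop) (by fun_prop) (by fun_prop) (by fun_prop)
    (by fun_prop) (by fun_prop) (fun σ => by simp only [hT hPa₀, hT hPa₁])
    (fun σ => by simp only [hT hPb₀, hT hPb₁]) (fun σ => by simp only [hT hPa₀, hT hPa₁])
    (fun σ => by simp only [hT hPb₀, hT hPb₁])
    (fun σ s t => hne _ _ (sq_nonneg _) (sq_nonneg _) (cos_sq_add_sin_sq σ) s t) 0 (π / 2)
  simp only [cos_zero, sin_zero, cos_pi_div_two, sin_pi_div_two, one_pow, one_smul, ne_eq,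
    OfNat.ofNat_ne_zero, not_false_eq_true, zero_pow, zero_smul, add_zero, zero_add] at key
  rw [gaussLinking, gaussLinking, key]

lemma gaussLinking_eq_of_norm_sub_lt {a₀ a₁ b₀ b₁ : ℝ → EuclideanSpace ℝ (Fin 3)}
    (ha₀ : ContDiff ℝ 1 a₀) (ha₁ : ContDiff ℝ 1 a₁) (hb₀ : ContDiff ℝ 1 b₀)
    (hb₁ : ContDiff ℝ 1 b₁) (hPa₀ : Function.Periodic a₀ (2 * π))
    (hPa₁ : Function.Periodic a₁ (2 * π)) (hPb₀ : Function.Periodic b₀ (2 * π))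
    (hPb₁ : Function.Periodic b₁ (2 * π))
    (hlt : ∀ s t, ‖a₁ s - a₀ s‖ + ‖b₁ t - b₀ t‖ < ‖a₀ s - b₀ t‖) :
    gaussLinking a₀ b₀ = gaussLinking a₁ b₁ := by
  refine gaussLinking_eq_of_segment ha₀ ha₁ hb₀ hb₁ hPa₀ hPa₁ hPb₀ hPb₁ ?_
  intro x y hx hy hxy s t h
  have h1 : a₀ s - b₀ t = y • ((b₁ t - b₀ t) - (a₁ s - a₀ s)) := by
    obtain rfl : x = 1 - y := by linarith
    rw [← sub_eq_zero] at h ⊢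
    rw [← h]
    module
  have h2 : ‖a₀ s - b₀ t‖ ≤ 1 * (‖b₁ t - b₀ t‖ + ‖a₁ s - a₀ s‖) := by
    rw [h1, norm_smul, Real.norm_of_nonneg hy]
    gcongr
    · linarith
    · exact norm_sub_le _ _
  linarith [hlt s t]

lemma Function.Periodic.exists_mem_Icc {α : Type*} {f : ℝ → α} (hf : Function.Periodic f (2 * π))
    (s : ℝ) : ∃ s' ∈ Set.Icc 0 (2 * π), f s = f s' :=
  let ⟨s', hs', h⟩ := hf.exists_mem_Ico₀ two_pi_pos s
  ⟨s', Set.Ico_subset_Icc_self hs', h⟩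

/-- The linking integral is constant along connected families of links. -/
lemma gaussLinking_eq_of_preconnectedSpace {X : Type*} [TopologicalSpace X] [PreconnectedSpace X]
    {a b : X → ℝ → EuclideanSpace ℝ (Fin 3)} (ca : Continuous fun p : X × ℝ => a p.1 p.2)
    (cb : Continuous fun p : X × ℝ => b p.1 p.2) (ha : ∀ x, ContDiff ℝ 1 (a x))
    (hb : ∀ x, ContDiff ℝ 1 (b x)) (hPa : ∀ x, Function.Periodic (a x) (2 * π))
    (hPb : ∀ x, Function.Periodic (b x) (2 * π)) (hne : ∀ x s t, a x s ≠ b x t) (x y : X) :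
    gaussLinking (a x) (b x) = gaussLinking (a y) (b y) := by
  have hloc : IsLocallyConstant fun x => gaussLinking (a x) (b x) := by
    rw [IsLocallyConstant.iff_eventually_eq]
    intro x₀
    have hK : IsCompact (Set.Icc 0 (2 * π) ×ˢ Set.Icc 0 (2 * π) : Set (ℝ × ℝ)) :=
      isCompact_Icc.prod isCompact_Icc
    have hev : ∀ᶠ x in nhds x₀, ∀ p ∈ (Set.Icc 0 (2 * π) ×ˢ Set.Icc 0 (2 * π) : Set (ℝ × ℝ)),
        ‖a x p.1 - a x₀ p.1‖ + ‖b x p.2 - b x₀ p.2‖ < ‖a x₀ p.1 - b x₀ p.2‖ := by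
      refine hK.eventually_forall_of_forall_eventually fun p _ => ?_
      have c1 : Continuous fun z : X × ℝ × ℝ => a z.1 z.2.1 :=
        ca.comp (by fun_prop : Continuous fun z : X × ℝ × ℝ => (z.1, z.2.1))
      have c2 : Continuous fun z : X × ℝ × ℝ => b z.1 z.2.2 :=
        cb.comp (by fun_prop : Continuous fun z : X × ℝ × ℝ => (z.1, z.2.2))
      have c3 : Continuous fun z : X × ℝ × ℝ => a x₀ z.2.1 := (ha x₀).continuous.comp (by fun_prop)
      have c4 : Continuous fun z : X × ℝ × ℝ => b x₀ z.2.2 := (hb x₀).continuous.comp (by fun_prop)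
      refine (isOpen_lt (f := fun z : X × ℝ × ℝ =>
        ‖a z.1 z.2.1 - a x₀ z.2.1‖ + ‖b z.1 z.2.2 - b x₀ z.2.2‖)
        (g := fun z => ‖a x₀ z.2.1 - b x₀ z.2.2‖) (by fun_prop) (by fun_prop)).mem_nhds ?_
      simpa [sub_eq_zero] using hne x₀ p.1 p.2
    filter_upwards [hev] with x hx
    refine (gaussLinking_eq_of_norm_sub_lt (ha x₀) (ha x) (hb x₀) (hb x) (hPa x₀) (hPa x) (hPb x₀)
      (hPb x) fun s t => ?_).symm
    obtain ⟨s', hs', h1⟩ := Function.Periodic.exists_mem_Icc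
      (f := fun s => (a x s, a x₀ s)) (fun s => by simp only [hPa x s, hPa x₀ s]) s
    obtain ⟨t', ht', h2⟩ := Function.Periodic.exists_mem_Icc
      (f := fun s => (b x s, b x₀ s)) (fun s => by simp only [hPb x s, hPb x₀ s]) t
    simp only [Prod.mk.injEq] at h1 h2
    rw [h1.1, h1.2, h2.1, h2.2]
    exact hx (s', t') ⟨hs', ht'⟩
  exact hloc.apply_eq_of_preconnectedSpace x y

lemma gaussLinking_eq_zero_of_deriv_left {γ₁ : ℝ → EuclideanSpace ℝ (Fin 3)}
    (h : ∀ s, deriv γ₁ s = 0) (γ₂ : ℝ → EuclideanSpace ℝ (Fin 3)) : gaussLinking γ₁ γ₂ = 0 := by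
  simp [gaussLinking, h, det3_eq]

lemma gaussLinking_eq_zero_of_deriv_right (γ₁ : ℝ → EuclideanSpace ℝ (Fin 3))
    {γ₂ : ℝ → EuclideanSpace ℝ (Fin 3)} (h : ∀ s, deriv γ₂ s = 0) : gaussLinking γ₁ γ₂ = 0 := by
  simp [gaussLinking, h, det3_eq]

section Steklov

variable {E : Type*} [NormedAddCommGroup E] [NormedSpace ℝ E]

/-- The forward average of a function over a window of length `h`. -/
def steklov (h : ℝ) (f : ℝ → E) (u : ℝ) : E := h⁻¹ • ∫ y in (0 : ℝ)..h, f (u + y)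

lemma contDiff_steklov [CompleteSpace E] (h : ℝ) {f : ℝ → E} (hf : Continuous f) : ContDiff ℝ 1 (steklov h f) := by
  have hd : ∀ u, HasDerivAt (steklov h f) (h⁻¹ • (f (u + h) - f u)) u := by
    intro u
    have hi : ∀ c d, IntervalIntegrable f volume c d := fun c d => hf.intervalIntegrable c d
    have hS : ∀ c, HasDerivAt (fun u => ∫ y in (0 : ℝ)..u, f y) (f c) c := fun c =>
      intervalIntegral.integral_hasDerivAt_right (hi _ _) (hf.stronglyMeasurableAtFilter _ _)
        hf.continuousAt
    have he : steklov h f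
        = fun u => h⁻¹ • ((∫ y in (0 : ℝ)..(u + h), f y) - ∫ y in (0 : ℝ)..u, f y) := by
      ext u
      rw [steklov, intervalIntegral.integral_comp_add_left f u, add_zero,
        intervalIntegral.integral_interval_sub_left (hi _ _) (hi _ _)]
    rw [he]
    exact (((hS (u + h)).comp_add_const u h).fun_sub (hS u)).fun_const_smul h⁻¹
  rw [contDiff_one_iff_deriv]
  refine ⟨fun u => (hd u).differentiableAt, ?_⟩
  rw [show deriv (steklov h f) = fun u => h⁻¹ • (f (u + h) - f u) from funext fun u => (hd u).deriv]
  fun_prop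

lemma continuous_steklov {X : Type*} [TopologicalSpace X] (h : ℝ) {f : X → ℝ → E}
    (hf : Continuous fun p : X × ℝ => f p.1 p.2) :
    Continuous fun p : X × ℝ => steklov h (f p.1) p.2 := by
  have hc : Continuous fun q : (X × ℝ) × ℝ => f q.1.1 (q.1.2 + q.2) :=
    hf.comp (by fun_prop : Continuous fun q : (X × ℝ) × ℝ => (q.1.1, q.1.2 + q.2))
  exact (intervalIntegral.continuous_parametric_intervalIntegral_of_continuous' hc _ _).const_smul _

lemma Function.Periodic.steklov {f : ℝ → E} {T : ℝ} (hf : Function.Periodic f T) (h : ℝ) :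
    Function.Periodic (steklov h f) T := by
  intro u
  have : ∀ y, f (u + T + y) = f (u + y) := fun y => by rw [add_right_comm, hf]
  simp only [_root_.steklov, this]

lemma norm_steklov_sub_le [CompleteSpace E] {h ε : ℝ} (hh : 0 < h) {f : ℝ → E} (hf : Continuous f) {u : ℝ}
    (hε : ∀ y ∈ Set.Icc 0 h, ‖f (u + y) - f u‖ ≤ ε) : ‖steklov h f u - f u‖ ≤ ε := by
  have h1 : steklov h f u - f u = h⁻¹ • ∫ y in (0 : ℝ)..h, (f (u + y) - f u) := by
    rw [intervalIntegral.integral_sub (Continuous.intervalIntegrable (by fun_prop) _ _)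
      (by simp), smul_sub, intervalIntegral.integral_const, sub_zero, inv_smul_smul₀ hh.ne']
    rfl
  have h2 : ‖∫ y in (0 : ℝ)..h, (f (u + y) - f u)‖ ≤ ε * |h - 0| := by
    refine intervalIntegral.norm_integral_le_of_norm_le_const fun y hy => hε y ?_
    rw [Set.uIoc_of_le hh.le] at hy
    exact Set.Ioc_subset_Icc_self hy
  rw [h1, norm_smul, norm_inv, Real.norm_of_nonneg hh.le]
  rw [sub_zero, abs_of_pos hh] at h2
  rw [inv_mul_le_iff₀ hh, mul_comm]
  exact h2

end Steklov

lemma exists_pos_le_norm_sub {E X : Type*} [NormedAddCommGroup E] [TopologicalSpace X]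
    {K : Set X} (hK : IsCompact K) {f g : X → ℝ → E} (cf : Continuous fun p : X × ℝ => f p.1 p.2)
    (cg : Continuous fun p : X × ℝ => g p.1 p.2) (hPf : ∀ x, Function.Periodic (f x) (2 * π))
    (hPg : ∀ x, Function.Periodic (g x) (2 * π)) (hne : ∀ x ∈ K, ∀ s t, f x s ≠ g x t) :
    ∃ d > 0, ∀ x ∈ K, ∀ s t, d ≤ ‖f x s - g x t‖ := by
  have hK' : IsCompact (K ×ˢ Set.Icc 0 (2 * π) ×ˢ Set.Icc 0 (2 * π) : Set (X × ℝ × ℝ)) :=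
    hK.prod (isCompact_Icc.prod isCompact_Icc)
  have c1 : Continuous fun z : X × ℝ × ℝ => f z.1 z.2.1 :=
    cf.comp (by fun_prop : Continuous fun z : X × ℝ × ℝ => (z.1, z.2.1))
  have c2 : Continuous fun z : X × ℝ × ℝ => g z.1 z.2.2 :=
    cg.comp (by fun_prop : Continuous fun z : X × ℝ × ℝ => (z.1, z.2.2))
  obtain ⟨d, hd, h⟩ := hK'.exists_forall_le' (f := fun z => ‖f z.1 z.2.1 - g z.1 z.2.2‖) (a := 0)
    (by fun_prop : Continuous _).continuousOn
    fun z hz => norm_pos_iff.mpr (sub_ne_zero.mpr (hne z.1 hz.1 _ _))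
  refine ⟨d, hd, fun x hx s t => ?_⟩
  obtain ⟨s', hs', h1⟩ := (hPf x).exists_mem_Icc s
  obtain ⟨t', ht', h2⟩ := (hPg x).exists_mem_Icc t
  rw [h1, h2]
  exact h (x, s', t') ⟨hx, hs', ht'⟩

/-- A periodic family over a compact base is uniformly equicontinuous. -/
lemma exists_norm_add_sub_le {E : Type*} [NormedAddCommGroup E] {K : Set ℝ} (hK : IsCompact K)
    {f : ℝ → ℝ → E} (cf : Continuous fun p : ℝ × ℝ => f p.1 p.2)
    (hP : ∀ x, Function.Periodic (f x) (2 * π)) {ε : ℝ} (hε : 0 < ε) :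
    ∃ h₀ > 0, ∀ x ∈ K, ∀ u, ∀ y ∈ Set.Icc 0 h₀, ‖f x (u + y) - f x u‖ ≤ ε := by
  have hK' : IsCompact (K ×ˢ Set.Icc 0 (2 * π) : Set (ℝ × ℝ)) := hK.prod isCompact_Icc
  have hev : ∀ᶠ y in nhds (0 : ℝ), ∀ p ∈ (K ×ˢ Set.Icc 0 (2 * π) : Set (ℝ × ℝ)),
      ‖f p.1 (p.2 + y) - f p.1 p.2‖ < ε := by
    refine hK'.eventually_forall_of_forall_eventually fun p _ => ?_
    have c1 : Continuous fun z : ℝ × ℝ × ℝ => f z.2.1 (z.2.2 + z.1) :=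
      cf.comp (by fun_prop : Continuous fun z : ℝ × ℝ × ℝ => (z.2.1, z.2.2 + z.1))
    have c2 : Continuous fun z : ℝ × ℝ × ℝ => f z.2.1 z.2.2 :=
      cf.comp (by fun_prop : Continuous fun z : ℝ × ℝ × ℝ => (z.2.1, z.2.2))
    refine (isOpen_lt (f := fun z : ℝ × ℝ × ℝ => ‖f z.2.1 (z.2.2 + z.1) - f z.2.1 z.2.2‖)
      (g := fun _ => ε) (by fun_prop) (by fun_prop)).mem_nhds ?_
    simpa using hε
  obtain ⟨δ, hδ, h⟩ := Metric.eventually_nhds_iff.mp hev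
  refine ⟨δ / 2, by positivity, fun x hx u y hy => ?_⟩
  obtain ⟨u', hu', h1⟩ := Function.Periodic.exists_mem_Icc
    (f := fun u => f x (u + y) - f x u)
    (fun u => by simp only [hP x u, add_right_comm u, hP x (u + y)]) u
  rw [h1]
  refine (h ?_ (x, u') ⟨hx, hu'⟩).le
  rw [Real.dist_eq, sub_zero, abs_of_nonneg hy.1]
  linarith [hy.2]

/-- A link that contracts, through disjoint continuous curves, to a link with a constant component
has vanishing linking integral. -/
lemma gaussLinking_eq_zero_of_homotopy {γ₁ γ₂ : ℝ → EuclideanSpace ℝ (Fin 3)}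
    (h₁ : ContDiff ℝ 1 γ₁) (h₂ : ContDiff ℝ 1 γ₂) (hP₁ : Function.Periodic γ₁ (2 * π))
    (hP₂ : Function.Periodic γ₂ (2 * π)) (hne : ∀ s t, γ₁ s ≠ γ₂ t)
    {m₁ m₂ : ℝ → ℝ → EuclideanSpace ℝ (Fin 3)} (cm₁ : Continuous fun p : ℝ × ℝ => m₁ p.1 p.2)
    (cm₂ : Continuous fun p : ℝ × ℝ => m₂ p.1 p.2) (hm₁ : ∀ τ, Function.Periodic (m₁ τ) (2 * π))
    (hm₂ : ∀ τ, Function.Periodic (m₂ τ) (2 * π)) {τ₀ : ℝ}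
    (hτ₀ : (∀ u v, m₁ τ₀ u = m₁ τ₀ v) ∨ ∀ u v, m₂ τ₀ u = m₂ τ₀ v)
    (hm : ∀ τ ≥ τ₀, ∀ s t, m₁ τ s ≠ m₂ τ t)
    (hlim₁ : ∀ ε > 0, ∃ T, ∀ τ ≥ T, ∀ u, ‖m₁ τ u - γ₁ u‖ < ε)
    (hlim₂ : ∀ ε > 0, ∃ T, ∀ τ ≥ T, ∀ u, ‖m₂ τ u - γ₂ u‖ < ε) : gaussLinking γ₁ γ₂ = 0 := by
  have cγ : ∀ {γ : ℝ → EuclideanSpace ℝ (Fin 3)}, ContDiff ℝ 1 γ →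
      Continuous fun p : ℝ × ℝ => γ p.2 := fun h => h.continuous.comp continuous_snd
  have cm : ∀ {m : ℝ → ℝ → EuclideanSpace ℝ (Fin 3)}, (Continuous fun p : ℝ × ℝ => m p.1 p.2) →
      ∀ τ, Continuous (m τ) := fun h τ => h.comp (by fun_prop : Continuous fun u : ℝ => (τ, u))
  obtain ⟨δ, hδ, hgap⟩ := exists_pos_le_norm_sub (isCompact_singleton (x := (0 : ℝ)))
    (f := fun _ => γ₁) (g := fun _ => γ₂) (cγ h₁) (cγ h₂) (fun _ => hP₁) (fun _ => hP₂)
    fun _ _ => hne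
  replace hgap := hgap 0 rfl
  obtain ⟨T₁, hT₁⟩ := hlim₁ (δ / 4) (by positivity)
  obtain ⟨T₂, hT₂⟩ := hlim₂ (δ / 4) (by positivity)
  obtain ⟨τ₁, hτ₁⟩ : ∃ τ₁, τ₁ = max τ₀ (max T₁ T₂) := ⟨_, rfl⟩
  have hτ₀₁ : τ₀ ≤ τ₁ := hτ₁ ▸ le_max_left _ _
  replace hT₁ := hT₁ τ₁ (hτ₁ ▸ (le_max_left _ _).trans (le_max_right _ _))
  replace hT₂ := hT₂ τ₁ (hτ₁ ▸ (le_max_right _ _).trans (le_max_right _ _))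
  have hK : IsCompact (Set.Icc τ₀ τ₁) := isCompact_Icc
  obtain ⟨d, hd, hgap'⟩ := exists_pos_le_norm_sub hK cm₁ cm₂ hm₁ hm₂ fun τ hτ => hm τ hτ.1
  obtain ⟨ε, hε, hεd, hεδ⟩ : ∃ ε > 0, ε ≤ d / 4 ∧ ε ≤ δ / 4 :=
    ⟨min (d / 4) (δ / 4), by positivity, min_le_left _ _, min_le_right _ _⟩
  obtain ⟨a, ha, hosc₁⟩ := exists_norm_add_sub_le hK cm₁ hm₁ hε
  obtain ⟨b, hb, hosc₂⟩ := exists_norm_add_sub_le hK cm₂ hm₂ hε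
  obtain ⟨h, hh, hha, hhb⟩ : ∃ h > 0, h ≤ a ∧ h ≤ b :=
    ⟨min a b, by positivity, min_le_left _ _, min_le_right _ _⟩
  have hs₁ : ∀ τ ∈ Set.Icc τ₀ τ₁, ∀ u, ‖steklov h (m₁ τ) u - m₁ τ u‖ ≤ ε := fun τ hτ u =>
    norm_steklov_sub_le hh (cm cm₁ τ) fun y hy => hosc₁ τ hτ u y ⟨hy.1, hy.2.trans hha⟩
  have hs₂ : ∀ τ ∈ Set.Icc τ₀ τ₁, ∀ u, ‖steklov h (m₂ τ) u - m₂ τ u‖ ≤ ε := fun τ hτ u =>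
    norm_steklov_sub_le hh (cm cm₂ τ) fun y hy => hosc₂ τ hτ u y ⟨hy.1, hy.2.trans hhb⟩
  have hend : gaussLinking γ₁ γ₂ = gaussLinking (steklov h (m₁ τ₁)) (steklov h (m₂ τ₁)) := by
    refine gaussLinking_eq_of_norm_sub_lt h₁ (contDiff_steklov h (cm cm₁ τ₁)) h₂
      (contDiff_steklov h (cm cm₂ τ₁)) hP₁ ((hm₁ τ₁).steklov h) hP₂ ((hm₂ τ₁).steklov h)
      fun s t => ?_
    have e₁ := norm_sub_le_norm_sub_add_norm_sub (steklov h (m₁ τ₁) s) (m₁ τ₁ s) (γ₁ s)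
    have e₂ := norm_sub_le_norm_sub_add_norm_sub (steklov h (m₂ τ₁) t) (m₂ τ₁ t) (γ₂ t)
    linarith [hs₁ τ₁ ⟨hτ₀₁, le_rfl⟩ s, hs₂ τ₁ ⟨hτ₀₁, le_rfl⟩ t, hT₁ s, hT₂ t, hgap s t]
  have : PreconnectedSpace (Set.Icc τ₀ τ₁) := Subtype.preconnectedSpace isPreconnected_Icc
  have csub : ∀ {m : ℝ → ℝ → EuclideanSpace ℝ (Fin 3)}, (Continuous fun p : ℝ × ℝ => m p.1 p.2) →
      Continuous fun p : Set.Icc τ₀ τ₁ × ℝ => m p.1 p.2 := fun hm =>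
    hm.comp (by fun_prop : Continuous fun p : Set.Icc τ₀ τ₁ × ℝ => ((p.1 : ℝ), p.2))
  have hcon := gaussLinking_eq_of_preconnectedSpace (X := Set.Icc τ₀ τ₁)
    (a := fun τ => steklov h (m₁ τ)) (b := fun τ => steklov h (m₂ τ))
    (continuous_steklov h (f := fun τ : Set.Icc τ₀ τ₁ => m₁ τ) (csub cm₁))
    (continuous_steklov h (f := fun τ : Set.Icc τ₀ τ₁ => m₂ τ) (csub cm₂))
    (fun τ => contDiff_steklov h (cm cm₁ τ)) (fun τ => contDiff_steklov h (cm cm₂ τ))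
    (fun τ => (hm₁ τ).steklov h) (fun τ => (hm₂ τ).steklov h) (fun τ s t heq => by
      have e₁ := norm_sub_le_norm_sub_add_norm_sub (m₁ τ s) (steklov h (m₁ τ) s) (m₂ τ t)
      have e₂ := hs₂ τ τ.2 t
      rw [norm_sub_rev (m₁ τ s) (steklov h (m₁ τ) s)] at e₁
      rw [← heq] at e₂
      linarith [hs₁ τ τ.2 s, hgap' τ τ.2 s t])
    ⟨τ₁, hτ₀₁, le_rfl⟩ ⟨τ₀, le_rfl, hτ₀₁⟩
  have hzero : ∀ {f : ℝ → EuclideanSpace ℝ (Fin 3)}, (∀ u v, f u = f v) →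
      ∀ u, deriv (steklov h f) u = 0 := by
    intro f hf u
    have : steklov h f = fun _ => steklov h f 0 := by
      ext1 v
      simp only [steklov, fun y => hf (v + y) (0 + y)]
    rw [this, deriv_const]
  rw [hend, hcon]
  rcases hτ₀ with h0 | h0
  · exact gaussLinking_eq_zero_of_deriv_left (hzero h0) _
  · exact gaussLinking_eq_zero_of_deriv_right _ (hzero h0)

lemma two_pi_sq_le_mobiusEnergy {γ₁ γ₂ : ℝ → EuclideanSpace ℝ (Fin 3)} (h₁ : ContDiff ℝ 1 γ₁)
    (h₂ : ContDiff ℝ 1 γ₂) (hP₁ : Function.Periodic γ₁ (2 * π))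
    (hP₂ : Function.Periodic γ₂ (2 * π)) (hne : ∀ s t, γ₁ s ≠ γ₂ t)
    (hlk : gaussLinking γ₁ γ₂ ≠ 0) : 2 * π ^ 2 ≤ mobiusEnergy γ₁ γ₂ := by
  obtain ⟨c₁, hc₁⟩ : ∃ c, deriv γ₁ c ≠ 0 := by
    by_contra! h
    exact hlk (gaussLinking_eq_zero_of_deriv_left h γ₂)
  obtain ⟨c₂, hc₂⟩ : ∃ c, deriv γ₂ c ≠ 0 := by
    by_contra! h
    exact hlk (gaussLinking_eq_zero_of_deriv_right γ₁ h)
  obtain ⟨m₁, τ₁, cm₁, hm₁, hcon₁, hflow₁, hlim₁⟩ := exists_center_homotopy h₁ hP₁ hc₁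
  obtain ⟨m₂, τ₂, cm₂, hm₂, hcon₂, hflow₂, hlim₂⟩ := exists_center_homotopy h₂ hP₂ hc₂
  by_cases hmeet : ∃ τ ≥ max τ₁ τ₂, ∃ u t, m₁ τ u = m₂ τ t
  · obtain ⟨τ, hτ, u, t, hut⟩ := hmeet
    obtain ⟨l, hl, hlτ⟩ := hflow₁ τ u ((le_max_left _ _).trans hτ)
    obtain ⟨k, hk, hkτ⟩ := hflow₂ τ t ((le_max_right _ _).trans hτ)
    exact two_pi_sq_le_mobiusEnergy_of_confCenter_eq h₁ h₂ hP₁ hP₂ hc₁ hc₂ hne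
      (hl.symm.trans (hut.trans hk)) (hlτ.trans hkτ.symm)
  · push Not at hmeet
    refine absurd (gaussLinking_eq_zero_of_homotopy h₁ h₂ hP₁ hP₂ hne cm₁ cm₂ hm₁ hm₂ ?_ hmeet
      hlim₁ hlim₂) hlk
    rcases max_choice τ₁ τ₂ with h | h <;> rw [h]
    exacts [.inl hcon₁, .inr hcon₂]

lemma hasDerivAt_toLp {ι : Type*} [Fintype ι] {f : ι → ℝ → ℝ} {f' : ι → ℝ} {x : ℝ}
    (h : ∀ i, HasDerivAt (f i) (f' i) x) :
    HasDerivAt (fun x => (WithLp.toLp 2 fun i => f i x : EuclideanSpace ℝ ι))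
      (WithLp.toLp 2 f') x :=
  (PiLp.continuousLinearEquiv 2 ℝ (fun _ : ι => ℝ)).symm.hasFDerivAt.comp_hasDerivAt x
    (hasDerivAt_pi.mpr h)

lemma abs_det3_le (u v w : EuclideanSpace ℝ (Fin 3)) : |det3 u v w| ≤ ‖u‖ * ‖v‖ * ‖w‖ := by
  refine abs_le_of_sq_le_sq ?_ (by positivity)
  simp only [mul_pow, EuclideanSpace.real_norm_sq_eq, Fin.sum_univ_three, det3_eq]
  rw [← sub_nonneg]
  refine le_of_le_of_eq (b := (u 0 * v 0 + u 1 * v 1 + u 2 * v 2) ^ 2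
      * (w 0 ^ 2 + w 1 ^ 2 + w 2 ^ 2)
    + ((u 1 * v 2 - u 2 * v 1) * w 1 - (u 2 * v 0 - u 0 * v 2) * w 0) ^ 2
    + ((u 1 * v 2 - u 2 * v 1) * w 2 - (u 0 * v 1 - u 1 * v 0) * w 0) ^ 2
    + ((u 2 * v 0 - u 0 * v 2) * w 2 - (u 0 * v 1 - u 1 * v 0) * w 1) ^ 2) (by positivity) ?_
  ring

/-- The first component of a stereographic projection of the Hopf link. -/
def hopfLeft (c d s : ℝ) : EuclideanSpace ℝ (Fin 3) :=
  !₂[c * cos s / (1 - d * cos s), sin s / (1 - d * cos s), 0]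

/-- The second component of a stereographic projection of the Hopf link. -/
def hopfRight (c d t : ℝ) : EuclideanSpace ℝ (Fin 3) :=
  !₂[-(d * cos t) / (1 - c * cos t), 0, sin t / (1 - c * cos t)]

/-- The velocity of `hopfLeft`. -/
def hopfLeftDeriv (c d s : ℝ) : EuclideanSpace ℝ (Fin 3) :=
  !₂[-(c * sin s) / (1 - d * cos s) ^ 2, (cos s - d) / (1 - d * cos s) ^ 2, 0]

/-- The velocity of `hopfRight`. -/
def hopfRightDeriv (c d t : ℝ) : EuclideanSpace ℝ (Fin 3) :=
  !₂[d * sin t / (1 - c * cos t) ^ 2, 0, (cos t - c) / (1 - c * cos t) ^ 2]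

lemma one_sub_mul_cos_pos {d : ℝ} (hd0 : 0 ≤ d) (hd : d < 1) (s : ℝ) : 0 < 1 - d * cos s := by
  nlinarith [cos_le_one s]

lemma hasDerivAt_cos_div {d s : ℝ} (h : 0 < 1 - d * cos s) (c : ℝ) :
    HasDerivAt (fun s => c * cos s / (1 - d * cos s)) (-(c * sin s) / (1 - d * cos s) ^ 2) s := by
  refine (((hasDerivAt_cos s).const_mul c).fun_div
    (((hasDerivAt_cos s).const_mul d).const_sub 1) h.ne').congr_deriv ?_
  ring

lemma hasDerivAt_sin_div {d s : ℝ} (h : 0 < 1 - d * cos s) :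
    HasDerivAt (fun s => sin s / (1 - d * cos s)) ((cos s - d) / (1 - d * cos s) ^ 2) s := by
  refine ((hasDerivAt_sin s).fun_div
    (((hasDerivAt_cos s).const_mul d).const_sub 1) h.ne').congr_deriv ?_
  congr 1
  linear_combination (-d) * sin_sq_add_cos_sq s

lemma hasDerivAt_hopfLeft {d s : ℝ} (h : 0 < 1 - d * cos s) (c : ℝ) :
    HasDerivAt (hopfLeft c d) (hopfLeftDeriv c d s) s := by
  have := hasDerivAt_toLp (f := ![fun s => c * cos s / (1 - d * cos s),
      fun s => sin s / (1 - d * cos s), fun _ => 0])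
    (f' := ![-(c * sin s) / (1 - d * cos s) ^ 2, (cos s - d) / (1 - d * cos s) ^ 2, 0]) (x := s)
    (fun i => by
      fin_cases i
      exacts [hasDerivAt_cos_div h c, hasDerivAt_sin_div h, hasDerivAt_const s 0])
  convert this using 1
  · ext s i
    fin_cases i <;> rfl
  · rfl

lemma hasDerivAt_hopfRight {c t : ℝ} (h : 0 < 1 - c * cos t) (d : ℝ) :
    HasDerivAt (hopfRight c d) (hopfRightDeriv c d t) t := by
  have := hasDerivAt_toLp (f := ![fun t => -(d * cos t) / (1 - c * cos t), fun _ => 0,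
      fun t => sin t / (1 - c * cos t)])
    (f' := ![d * sin t / (1 - c * cos t) ^ 2, 0, (cos t - c) / (1 - c * cos t) ^ 2]) (x := t)
    (fun i => by
      fin_cases i
      exacts [by simpa using hasDerivAt_cos_div h (-d), hasDerivAt_const t 0, hasDerivAt_sin_div h])
  convert this using 1
  · ext t i
    fin_cases i <;> rfl
  · rfl

lemma norm_hopfLeftDeriv {c d s : ℝ} (hcd : c ^ 2 + d ^ 2 = 1) (h : 0 < 1 - d * cos s) :
    ‖hopfLeftDeriv c d s‖ = 1 / (1 - d * cos s) := by
  rw [← sq_eq_sq₀ (norm_nonneg _) (by positivity), EuclideanSpace.real_norm_sq_eq,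
    Fin.sum_univ_three]
  simp [hopfLeftDeriv]
  field_simp
  linear_combination (1 - cos s ^ 2) * hcd + c ^ 2 * sin_sq_add_cos_sq s

lemma norm_hopfRightDeriv {c d t : ℝ} (hcd : c ^ 2 + d ^ 2 = 1) (h : 0 < 1 - c * cos t) :
    ‖hopfRightDeriv c d t‖ = 1 / (1 - c * cos t) := by
  rw [← sq_eq_sq₀ (norm_nonneg _) (by positivity), EuclideanSpace.real_norm_sq_eq,
    Fin.sum_univ_three]
  simp [hopfRightDeriv]
  field_simp
  linear_combination (1 - cos t ^ 2) * hcd + d ^ 2 * sin_sq_add_cos_sq t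

lemma norm_hopfLeft_sub_hopfRight_sq {c d s t : ℝ} (hcd : c ^ 2 + d ^ 2 = 1)
    (hs : 0 < 1 - d * cos s) (ht : 0 < 1 - c * cos t) :
    ‖hopfLeft c d s - hopfRight c d t‖ ^ 2 = 2 / ((1 - d * cos s) * (1 - c * cos t)) := by
  have key : (c * cos s / (1 - d * cos s) - -(d * cos t) / (1 - c * cos t)) ^ 2
      + (sin s / (1 - d * cos s) - 0) ^ 2 + (0 - sin t / (1 - c * cos t)) ^ 2
      = 2 / ((1 - d * cos s) * (1 - c * cos t)) := by
    have h := hs.ne'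
    have h' := ht.ne'
    generalize hA : 1 - d * cos s = A at h ⊢
    generalize hB : 1 - c * cos t = B at h' ⊢
    have hz : (c * cos s * B + d * cos t * A) ^ 2 + (sin s * B) ^ 2 + (sin t * A) ^ 2
        = 2 * A * B := by
      rw [← hA, ← hB]
      linear_combination (1 - c * cos t) ^ 2 * (cos s ^ 2 * hcd + sin_sq_add_cos_sq s)
        + (1 - d * cos s) ^ 2 * (cos t ^ 2 * hcd + sin_sq_add_cos_sq t)
    trans (2 * A * B) / (A * B) ^ 2
    · rw [← hz]
      field_simp
      ring
    · field_simp
  rw [EuclideanSpace.real_norm_sq_eq, Fin.sum_univ_three]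
  exact key

lemma hopfLeft_ne_hopfRight {c d : ℝ} (hcd : c ^ 2 + d ^ 2 = 1) {s t : ℝ}
    (hs : 0 < 1 - d * cos s) (ht : 0 < 1 - c * cos t) : hopfLeft c d s ≠ hopfRight c d t := by
  intro h
  have := norm_hopfLeft_sub_hopfRight_sq hcd hs ht
  rw [h, sub_self, norm_zero] at this
  have h2 : 0 < 2 / ((1 - d * cos s) * (1 - c * cos t)) := by positivity
  rw [← this] at h2
  norm_num at h2

lemma periodic_hopfLeft (c d : ℝ) : Function.Periodic (hopfLeft c d) (2 * π) := by
  intro s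
  simp [hopfLeft]

lemma periodic_hopfRight (c d : ℝ) : Function.Periodic (hopfRight c d) (2 * π) := by
  intro s
  simp [hopfRight]

lemma continuous_hopfLeftDeriv {c d : ℝ} (hd0 : 0 ≤ d) (hd : d < 1) :
    Continuous (hopfLeftDeriv c d) := by
  refine (PiLp.continuous_toLp 2 _).comp (continuous_pi fun i => ?_)
  have h : ∀ s, (1 - d * cos s) ^ 2 ≠ 0 := fun s => (pow_pos (one_sub_mul_cos_pos hd0 hd s) 2).ne'
  fin_cases i
  · exact (by fun_prop : Continuous fun s => -(c * sin s)).div (by fun_prop) h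
  · exact (by fun_prop : Continuous fun s => cos s - d).div (by fun_prop) h
  · exact continuous_const

lemma continuous_hopfRightDeriv {c d : ℝ} (hc0 : 0 ≤ c) (hc : c < 1) :
    Continuous (hopfRightDeriv c d) := by
  refine (PiLp.continuous_toLp 2 _).comp (continuous_pi fun i => ?_)
  have h : ∀ s, (1 - c * cos s) ^ 2 ≠ 0 := fun s => (pow_pos (one_sub_mul_cos_pos hc0 hc s) 2).ne'
  fin_cases i
  · exact (by fun_prop : Continuous fun s => d * sin s).div (by fun_prop) h
  · exact continuous_const
  · exact (by fun_prop : Continuous fun s => cos s - c).div (by fun_prop) h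

lemma contDiff_hopfLeft (c : ℝ) {d : ℝ} (hd0 : 0 ≤ d) (hd : d < 1) :
    ContDiff ℝ 1 (hopfLeft c d) := by
  have h := fun s => hasDerivAt_hopfLeft (one_sub_mul_cos_pos hd0 hd s) c
  rw [contDiff_one_iff_deriv, deriv_eq h]
  exact ⟨fun s => (h s).differentiableAt, continuous_hopfLeftDeriv hd0 hd⟩

lemma contDiff_hopfRight {c : ℝ} (d : ℝ) (hc0 : 0 ≤ c) (hc : c < 1) :
    ContDiff ℝ 1 (hopfRight c d) := by
  have h := fun s => hasDerivAt_hopfRight (one_sub_mul_cos_pos hc0 hc s) d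
  rw [contDiff_one_iff_deriv, deriv_eq h]
  exact ⟨fun s => (h s).differentiableAt, continuous_hopfRightDeriv hc0 hc⟩

lemma mobiusEnergy_hopf {c d : ℝ} (hcd : c ^ 2 + d ^ 2 = 1) (hc0 : 0 < c) (hd0 : 0 < d) :
    mobiusEnergy (hopfLeft c d) (hopfRight c d) = 2 * π ^ 2 := by
  have hc : c < 1 := by nlinarith
  have hd : d < 1 := by nlinarith
  have h : ∀ s t, ‖deriv (hopfLeft c d) s‖ * ‖deriv (hopfRight c d) t‖
      / ‖hopfLeft c d s - hopfRight c d t‖ ^ 2 = 1 / 2 := by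
    intro s t
    have hs := one_sub_mul_cos_pos hd0.le hd s
    have ht := one_sub_mul_cos_pos hc0.le hc t
    rw [(hasDerivAt_hopfLeft hs c).deriv, (hasDerivAt_hopfRight ht d).deriv,
      norm_hopfLeftDeriv hcd hs, norm_hopfRightDeriv hcd ht,
      norm_hopfLeft_sub_hopfRight_sq hcd hs ht]
    field_simp
  simp only [mobiusEnergy, h, intervalIntegral.integral_const, smul_eq_mul]
  ring

lemma integral_sin_half : ∫ t in (0 : ℝ)..(2 * π), sin (t / 2) = 4 := by
  rw [intervalIntegral.integral_comp_div sin two_ne_zero, integral_sin]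
  norm_num

/-- The Gauss integrand of the stereographic Hopf link. -/
def hopfIntegrand (c d s t : ℝ) : ℝ :=
  det3 (hopfLeftDeriv c d s) (hopfRightDeriv c d t) (hopfLeft c d s - hopfRight c d t)
    / ‖hopfLeft c d s - hopfRight c d t‖ ^ 3

lemma one_sub_cos_eq (t : ℝ) : 1 - cos t = 2 * sin (t / 2) ^ 2 := by
  rw [sin_sq_eq_half_sub, mul_div_cancel₀ t two_ne_zero]
  ring

lemma hopfIntegrand_one_zero {t : ℝ} (h0 : 0 < t) (h1 : t < 2 * π) (s : ℝ) :
    hopfIntegrand 1 0 s t = -(1 / 2) * sin (t / 2) := by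
  have hx : 0 < sin (t / 2) := sin_pos_of_pos_of_lt_pi (by linarith) (by linarith)
  have hc := one_sub_cos_eq t
  have hcp : 0 < 1 - cos t := by rw [hc]; positivity
  have hn : ‖hopfLeft 1 0 s - hopfRight 1 0 t‖ = 1 / sin (t / 2) := by
    rw [← sq_eq_sq₀ (norm_nonneg _) (by positivity),
      norm_hopfLeft_sub_hopfRight_sq (by norm_num) (by simp) (by simpa using hcp), one_mul, hc]
    field_simp
    simp
  have hd : det3 (hopfLeftDeriv 1 0 s) (hopfRightDeriv 1 0 t)
      (hopfLeft 1 0 s - hopfRight 1 0 t) = -(1 / (1 - cos t)) := by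
    simp [det3_eq, hopfLeftDeriv, hopfRightDeriv, hopfLeft, hopfRight]
    field_simp
    linear_combination (cos t - 1) * sin_sq_add_cos_sq s
  rw [hopfIntegrand, hn, hd, hc]
  field_simp

lemma abs_hopfIntegrand_le {c d s t : ℝ} (hcd : c ^ 2 + d ^ 2 = 1)
    (hs : 0 < 1 - d * cos s) (ht : 0 < 1 - c * cos t) : |hopfIntegrand c d s t| ≤ 1 / 2 := by
  have hn : 0 < ‖hopfLeft c d s - hopfRight c d t‖ :=
    norm_pos_iff.mpr (sub_ne_zero.mpr (hopfLeft_ne_hopfRight hcd hs ht))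
  have hsq := norm_hopfLeft_sub_hopfRight_sq hcd hs ht
  rw [hopfIntegrand, abs_div, abs_of_pos (pow_pos hn 3), div_le_iff₀ (pow_pos hn 3)]
  refine (abs_det3_le _ _ _).trans_eq ?_
  rw [norm_hopfLeftDeriv hcd hs, norm_hopfRightDeriv hcd ht, pow_succ, hsq]
  field_simp

lemma continuous_hopfIntegrand {c d : ℝ} (hcd : c ^ 2 + d ^ 2 = 1) (hc0 : 0 ≤ c) (hc : c < 1)
    (hd0 : 0 ≤ d) (hd : d < 1) : Continuous fun p : ℝ × ℝ => hopfIntegrand c d p.1 p.2 := by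
  have h1 := (contDiff_hopfLeft c hd0 hd).continuous
  have h2 := (contDiff_hopfRight d hc0 hc).continuous
  have h3 := continuous_hopfLeftDeriv (c := c) hd0 hd
  have h4 := continuous_hopfRightDeriv (d := d) hc0 hc
  refine Continuous.div (Continuous.det3 (by fun_prop) (by fun_prop) (by fun_prop))
    (by fun_prop) fun p => ?_
  exact pow_ne_zero _ (norm_ne_zero_iff.mpr (sub_ne_zero.mpr (hopfLeft_ne_hopfRight hcd
    (one_sub_mul_cos_pos hd0 hd _) (one_sub_mul_cos_pos hc0 hc _))))

lemma ContinuousAt.vec3 {X : Type*} [TopologicalSpace X] {f g h : X → ℝ} {x : X}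
    (hf : ContinuousAt f x) (hg : ContinuousAt g x) (hh : ContinuousAt h x) :
    ContinuousAt (fun x => (!₂[f x, g x, h x] : EuclideanSpace ℝ (Fin 3))) x := by
  refine (PiLp.continuous_toLp 2 _).continuousAt.comp (continuousAt_pi.mpr fun i => ?_)
  fin_cases i
  exacts [hf, hg, hh]

lemma continuousAt_hopfIntegrand {φ s t : ℝ} (hs : 0 < 1 - sin φ * cos s)
    (ht : 0 < 1 - cos φ * cos t) :
    ContinuousAt (fun φ => hopfIntegrand (cos φ) (sin φ) s t) φ := by
  have hl : ContinuousAt (fun φ => hopfLeft (cos φ) (sin φ) s) φ :=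
    .vec3 (.div (by fun_prop) (by fun_prop) hs.ne') (.div (by fun_prop) (by fun_prop) hs.ne')
      continuousAt_const
  have hr : ContinuousAt (fun φ => hopfRight (cos φ) (sin φ) t) φ :=
    .vec3 (.div (by fun_prop) (by fun_prop) ht.ne') continuousAt_const
      (.div (by fun_prop) (by fun_prop) ht.ne')
  have hl' : ContinuousAt (fun φ => hopfLeftDeriv (cos φ) (sin φ) s) φ :=
    .vec3 (.div (by fun_prop) (by fun_prop) (pow_pos hs 2).ne')
      (.div (by fun_prop) (by fun_prop) (pow_pos hs 2).ne') continuousAt_const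
  have hr' : ContinuousAt (fun φ => hopfRightDeriv (cos φ) (sin φ) t) φ :=
    .vec3 (.div (by fun_prop) (by fun_prop) (pow_pos ht 2).ne') continuousAt_const
      (.div (by fun_prop) (by fun_prop) (pow_pos ht 2).ne')
  have hdet : Continuous fun p : EuclideanSpace ℝ (Fin 3) × EuclideanSpace ℝ (Fin 3)
      × EuclideanSpace ℝ (Fin 3) => det3 p.1 p.2.1 p.2.2 :=
    Continuous.det3 (by fun_prop) (by fun_prop) (by fun_prop)
  have hd : ContinuousAt (fun φ => det3 (hopfLeftDeriv (cos φ) (sin φ) s)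
      (hopfRightDeriv (cos φ) (sin φ) t)
      (hopfLeft (cos φ) (sin φ) s - hopfRight (cos φ) (sin φ) t)) φ :=
    hdet.continuousAt.comp (f := fun φ => (hopfLeftDeriv (cos φ) (sin φ) s,
      hopfRightDeriv (cos φ) (sin φ) t, hopfLeft (cos φ) (sin φ) s - hopfRight (cos φ) (sin φ) t))
      (hl'.prodMk (hr'.prodMk (hl.sub hr)))
  unfold hopfIntegrand
  exact hd.div ((hl.sub hr).norm.pow 3) (pow_ne_zero _ (norm_ne_zero_iff.mpr (sub_ne_zero.mpr
    (hopfLeft_ne_hopfRight (cos_sq_add_sin_sq φ) hs ht))))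

lemma sin_mem_Ioo_of_mem_Ioo {φ : ℝ} (hφ : φ ∈ Set.Ioo 0 (π / 2)) : sin φ ∈ Set.Ioo 0 1 := by
  have h1 := sin_pos_of_mem_Ioo (x := φ) ⟨hφ.1, by linarith [hφ.2, pi_pos]⟩
  have h2 := cos_pos_of_mem_Ioo (x := φ) ⟨by linarith [hφ.1, pi_pos], hφ.2⟩
  exact ⟨h1, by nlinarith [sin_sq_add_cos_sq φ]⟩

lemma cos_mem_Ioo_of_mem_Ioo {φ : ℝ} (hφ : φ ∈ Set.Ioo 0 (π / 2)) : cos φ ∈ Set.Ioo 0 1 := by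
  rw [← sin_pi_div_two_sub]
  exact sin_mem_Ioo_of_mem_Ioo ⟨by linarith [hφ.2], by linarith [hφ.1]⟩

lemma gaussLinking_hopf {c d : ℝ} (hc0 : 0 ≤ c) (hc : c < 1) (hd0 : 0 ≤ d) (hd : d < 1) :
    gaussLinking (hopfLeft c d) (hopfRight c d) = (1 / (4 * π)) * ∫ s in (0 : ℝ)..(2 * π),
      ∫ t in (0 : ℝ)..(2 * π), hopfIntegrand c d s t := by
  have h1 : deriv (hopfLeft c d) = hopfLeftDeriv c d :=
    deriv_eq fun s => hasDerivAt_hopfLeft (one_sub_mul_cos_pos hd0 hd s) c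
  have h2 : deriv (hopfRight c d) = hopfRightDeriv c d :=
    deriv_eq fun s => hasDerivAt_hopfRight (one_sub_mul_cos_pos hc0 hc s) d
  simp only [gaussLinking, h1, h2, hopfIntegrand]

lemma tendsto_gaussLinking_hopf :
    Filter.Tendsto (fun φ => gaussLinking (hopfLeft (cos φ) (sin φ)) (hopfRight (cos φ) (sin φ)))
      (nhdsWithin 0 (Set.Ioi 0)) (nhds (-1)) := by
  have hev : ∀ᶠ φ in nhdsWithin (0 : ℝ) (Set.Ioi 0), φ ∈ Set.Ioo 0 (π / 2) :=
    Ioo_mem_nhdsGT (by positivity)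
  have hcont : ∀ φ ∈ Set.Ioo 0 (π / 2),
      Continuous fun p : ℝ × ℝ => hopfIntegrand (cos φ) (sin φ) p.1 p.2 := fun φ hφ =>
    have hc := cos_mem_Ioo_of_mem_Ioo hφ
    have hd := sin_mem_Ioo_of_mem_Ioo hφ
    continuous_hopfIntegrand (cos_sq_add_sin_sq φ) hc.1.le hc.2 hd.1.le hd.2
  have hle : ∀ φ ∈ Set.Ioo 0 (π / 2), ∀ s t, ‖hopfIntegrand (cos φ) (sin φ) s t‖ ≤ 1 / 2 :=
    fun φ hφ s t =>
    have hc := cos_mem_Ioo_of_mem_Ioo hφ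
    have hd := sin_mem_Ioo_of_mem_Ioo hφ
    abs_hopfIntegrand_le (cos_sq_add_sin_sq φ) (one_sub_mul_cos_pos hd.1.le hd.2 s)
      (one_sub_mul_cos_pos hc.1.le hc.2 t)
  have hinner : ∀ s, Filter.Tendsto
      (fun φ => ∫ t in (0 : ℝ)..(2 * π), hopfIntegrand (cos φ) (sin φ) s t)
      (nhdsWithin 0 (Set.Ioi 0)) (nhds (-2)) := by
    intro s
    have hval : ∫ t in (0 : ℝ)..(2 * π), -(1 / 2) * sin (t / 2) = -2 := by
      rw [intervalIntegral.integral_const_mul, integral_sin_half]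
      norm_num
    rw [← hval]
    refine intervalIntegral.tendsto_integral_filter_of_dominated_convergence (fun _ => 1 / 2)
      ?_ ?_ intervalIntegrable_const ?_
    · filter_upwards [hev] with φ hφ
      exact ((hcont φ hφ).comp (by fun_prop : Continuous fun t : ℝ => (s, t))).aestronglyMeasurable
    · filter_upwards [hev] with φ hφ
      exact .of_forall fun t _ => hle φ hφ s t
    · filter_upwards [(Set.countable_singleton (2 * π)).ae_notMem volume] with t ht htm
      rw [Set.uIoc_of_le (by positivity)] at htm
      have ht2 : t < 2 * π := lt_of_le_of_ne htm.2 ht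
      rw [← hopfIntegrand_one_zero htm.1 ht2 s]
      have hx : 0 < sin (t / 2) := sin_pos_of_pos_of_lt_pi (by linarith [htm.1]) (by linarith)
      have hct : 0 < 1 - cos t := by
        rw [one_sub_cos_eq]
        positivity
      simpa using (continuousAt_hopfIntegrand (φ := 0) (s := s) (t := t) (by simp)
        (by simpa using hct)).tendsto.mono_left nhdsWithin_le_nhds
  have houter : Filter.Tendsto (fun φ => ∫ s in (0 : ℝ)..(2 * π), ∫ t in (0 : ℝ)..(2 * π),
      hopfIntegrand (cos φ) (sin φ) s t) (nhdsWithin 0 (Set.Ioi 0))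
      (nhds (∫ _ in (0 : ℝ)..(2 * π), (-2 : ℝ))) := by
    refine intervalIntegral.tendsto_integral_filter_of_dominated_convergence
      (fun _ => 1 / 2 * |2 * π - 0|) ?_ ?_ intervalIntegrable_const (.of_forall fun s _ => hinner s)
    · filter_upwards [hev] with φ hφ
      exact (intervalIntegral.continuous_parametric_intervalIntegral_of_continuous'
        (hcont φ hφ) 0 (2 * π)).aestronglyMeasurable
    · filter_upwards [hev] with φ hφ
      exact .of_forall fun s _ =>
        intervalIntegral.norm_integral_le_of_norm_le_const fun t _ => hle φ hφ s t
  have hlim : (1 / (4 * π)) * (∫ _ in (0 : ℝ)..(2 * π), (-2 : ℝ)) = -1 := by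
    rw [intervalIntegral.integral_const, smul_eq_mul]
    field_simp
    ring
  rw [← hlim]
  refine (houter.const_mul _).congr' ?_
  filter_upwards [hev] with φ hφ
  have hc := cos_mem_Ioo_of_mem_Ioo hφ
  have hd := sin_mem_Ioo_of_mem_Ioo hφ
  exact (gaussLinking_hopf hc.1.le hc.2 hd.1.le hd.2).symm

lemma gaussLinking_hopf_eq_neg_one {φ : ℝ} (hφ : φ ∈ Set.Ioo 0 (π / 2)) :
    gaussLinking (hopfLeft (cos φ) (sin φ)) (hopfRight (cos φ) (sin φ)) = -1 := by
  have : PreconnectedSpace (Set.Ioo 0 (π / 2)) :=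
    Subtype.preconnectedSpace isPreconnected_Ioo
  have hs : ∀ (x : Set.Ioo 0 (π / 2)) (s : ℝ), 0 < 1 - sin (x : ℝ) * cos s := fun x s =>
    one_sub_mul_cos_pos (sin_mem_Ioo_of_mem_Ioo x.2).1.le (sin_mem_Ioo_of_mem_Ioo x.2).2 s
  have ht : ∀ (x : Set.Ioo 0 (π / 2)) (s : ℝ), 0 < 1 - cos (x : ℝ) * cos s := fun x s =>
    one_sub_mul_cos_pos (cos_mem_Ioo_of_mem_Ioo x.2).1.le (cos_mem_Ioo_of_mem_Ioo x.2).2 s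
  have hconst := gaussLinking_eq_of_preconnectedSpace (X := Set.Ioo 0 (π / 2))
    (a := fun x => hopfLeft (cos x) (sin x)) (b := fun x => hopfRight (cos x) (sin x))
    (by
      refine (PiLp.continuous_toLp 2 _).comp (continuous_pi fun i => ?_)
      fin_cases i
      · exact (by fun_prop : Continuous fun p : Set.Ioo 0 (π / 2) × ℝ =>
          cos (p.1 : ℝ) * cos p.2).div (by fun_prop) fun p => (hs p.1 p.2).ne'
      · exact (by fun_prop : Continuous fun p : Set.Ioo 0 (π / 2) × ℝ =>
          sin p.2).div (by fun_prop) fun p => (hs p.1 p.2).ne'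
      · exact continuous_const)
    (by
      refine (PiLp.continuous_toLp 2 _).comp (continuous_pi fun i => ?_)
      fin_cases i
      · exact (by fun_prop : Continuous fun p : Set.Ioo 0 (π / 2) × ℝ =>
          -(sin (p.1 : ℝ) * cos p.2)).div (by fun_prop) fun p => (ht p.1 p.2).ne'
      · exact continuous_const
      · exact (by fun_prop : Continuous fun p : Set.Ioo 0 (π / 2) × ℝ =>
          sin p.2).div (by fun_prop) fun p => (ht p.1 p.2).ne')
    (fun x => contDiff_hopfLeft _ (sin_mem_Ioo_of_mem_Ioo x.2).1.le (sin_mem_Ioo_of_mem_Ioo x.2).2)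
    (fun x => contDiff_hopfRight _ (cos_mem_Ioo_of_mem_Ioo x.2).1.le (cos_mem_Ioo_of_mem_Ioo x.2).2)
    (fun x => periodic_hopfLeft _ _) (fun x => periodic_hopfRight _ _)
    (fun x s t => hopfLeft_ne_hopfRight (cos_sq_add_sin_sq _) (hs x s) (ht x t))
  refine tendsto_nhds_unique (tendsto_const_nhds.congr' ?_) tendsto_gaussLinking_hopf
  filter_upwards [Ioo_mem_nhdsGT (by positivity : (0 : ℝ) < π / 2)] with ψ hψ
  exact hconst ⟨φ, hφ⟩ ⟨ψ, hψ⟩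

/-- The infimum of the Möbius cross energy over all `2`-component links in `ℝ³` with
linking number `±1` equals `2π²`, and it is attained. -/
theorem mobiusEnergy_isLeast :
    IsLeast
      { e : ℝ | ∃ γ₁ γ₂ : ℝ → EuclideanSpace ℝ (Fin 3),
          ContDiff ℝ 1 γ₁ ∧ ContDiff ℝ 1 γ₂ ∧
          Function.Periodic γ₁ (2 * π) ∧ Function.Periodic γ₂ (2 * π) ∧
          (∀ s t, γ₁ s ≠ γ₂ t) ∧
          |gaussLinking γ₁ γ₂| = 1 ∧
          e = mobiusEnergy γ₁ γ₂ }
      (2 * π ^ 2) := by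
  constructor
  · have hφ : π / 4 ∈ Set.Ioo 0 (π / 2) := ⟨by positivity, by linarith [pi_pos]⟩
    have hc := cos_mem_Ioo_of_mem_Ioo hφ
    have hd := sin_mem_Ioo_of_mem_Ioo hφ
    have hcd := cos_sq_add_sin_sq (π / 4)
    refine ⟨_, _, contDiff_hopfLeft _ hd.1.le hd.2, contDiff_hopfRight _ hc.1.le hc.2,
      periodic_hopfLeft _ _, periodic_hopfRight _ _, fun s t => hopfLeft_ne_hopfRight hcd
        (one_sub_mul_cos_pos hd.1.le hd.2 s) (one_sub_mul_cos_pos hc.1.le hc.2 t), ?_,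
      (mobiusEnergy_hopf hcd hc.1 hd.1).symm⟩
    rw [gaussLinking_hopf_eq_neg_one hφ, abs_neg, abs_one]
  · rintro e ⟨γ₁, γ₂, h₁, h₂, hP₁, hP₂, hne, hlk, rfl⟩
    refine two_pi_sq_le_mobiusEnergy h₁ h₂ hP₁ hP₂ hne fun h => ?_
    simp [h] at hlk

end
end

section
/- The Möbius cross energy is invariant under the inversion x ↦ x/‖x‖² of ℝ³. Precisely: if γ₁, γ₂ : ℝ → ℝ³ are C¹, 2π-periodic, with disjoint images, and neither image contains the origin, then with I(x) = x/‖x‖² one has E(I∘γ₁, I∘γ₂) = E(γ₁, γ₂). -/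
open Real MeasureTheory

noncomputable section

/-- Inversion of `ℝ³` in the unit sphere: `x ↦ x/‖x‖²`. -/
def sphereInv (x : EuclideanSpace ℝ (Fin 3)) : EuclideanSpace ℝ (Fin 3) :=
  (‖x‖ ^ 2)⁻¹ • x

theorem sphereInv_eq_inversion : sphereInv = EuclideanGeometry.inversion 0 1 := by
  ext1 x
  simp [sphereInv, EuclideanGeometry.inversion]

theorem norm_sphereInv_sub_sphereInv {x y : EuclideanSpace ℝ (Fin 3)} (hx : x ≠ 0) (hy : y ≠ 0) :
    ‖sphereInv x - sphereInv y‖ = ‖x - y‖ / (‖x‖ * ‖y‖) := by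
  have h := EuclideanGeometry.dist_inversion_inversion hx hy 1
  rw [sphereInv_eq_inversion, ← dist_eq_norm, h, dist_zero_right, dist_zero_right, dist_eq_norm]
  ring

theorem norm_deriv_sphereInv_comp {γ : ℝ → EuclideanSpace ℝ (Fin 3)} {s : ℝ}
    (hγ : DifferentiableAt ℝ γ s) (h0 : γ s ≠ 0) :
    ‖deriv (sphereInv ∘ γ) s‖ = ‖deriv γ s‖ / ‖γ s‖ ^ 2 := by
  have h := (EuclideanGeometry.hasFDerivAt_inversion (R := 1) h0).comp_hasDerivAt s hγ.hasDerivAt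
  rw [sphereInv_eq_inversion, h.deriv]
  simp [norm_smul]
  ring

/-- The Möbius cross energy is invariant under the inversion `x ↦ x/‖x‖²` of `ℝ³`
(Freedman–He–Wang). -/
theorem mobiusEnergy_inversion_invariant (γ₁ γ₂ : ℝ → EuclideanSpace ℝ (Fin 3))
    (h₁ : ContDiff ℝ 1 γ₁) (h₂ : ContDiff ℝ 1 γ₂)
    (hper₁ : Function.Periodic γ₁ (2 * π)) (hper₂ : Function.Periodic γ₂ (2 * π))
    (hdisj : ∀ s t, γ₁ s ≠ γ₂ t)
    (h0₁ : ∀ s, γ₁ s ≠ 0) (h0₂ : ∀ t, γ₂ t ≠ 0) :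
    mobiusEnergy (sphereInv ∘ γ₁) (sphereInv ∘ γ₂) = mobiusEnergy γ₁ γ₂ := by
  unfold mobiusEnergy
  congr! 4 with s t
  rw [norm_deriv_sphereInv_comp (h₁.differentiable one_ne_zero s) (h0₁ s),
    norm_deriv_sphereInv_comp (h₂.differentiable one_ne_zero t) (h0₂ t),
    Function.comp_apply, Function.comp_apply, norm_sphereInv_sub_sphereInv (h0₁ s) (h0₂ t)]
  have hs : ‖γ₁ s‖ ≠ 0 := norm_ne_zero_iff.mpr (h0₁ s)
  have ht : ‖γ₂ t‖ ≠ 0 := norm_ne_zero_iff.mpr (h0₂ t)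
  have hst : ‖γ₁ s - γ₂ t‖ ≠ 0 := norm_ne_zero_iff.mpr (sub_ne_zero.mpr (hdisj s t))
  field_simp

end
end

section
/- The Möbius cross energy is invariant under stereographic projection: if γ₁, γ₂ : ℝ → S³ ⊂ ℝ⁴ are C¹, 2π-periodic, with disjoint images, and p ∈ S³ lies on neither image, then with π_p the stereographic projection of S³ from p one has E(π_p∘γ₁, π_p∘γ₂) = E(γ₁, γ₂), where both energies are computed with the ambient Euclidean distance (of ℝ³ and ℝ⁴ respectively). -/
open Real MeasureTheory

noncomputable section

open RealInnerProductSpace in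
/-- Stereographic projection of `S³ ⊂ ℝ⁴` from the pole `p`, landing in the hyperplane
through the origin orthogonal to `p` (a copy of `ℝ³` with its Euclidean distance):
the ray from `p` through `x` meets that hyperplane at `(x − ⟪x,p⟫p)/(1 − ⟪x,p⟫)`. -/
def sterProjFrom (p x : EuclideanSpace ℝ (Fin 4)) : EuclideanSpace ℝ (Fin 4) :=
  (1 - ⟪x, p⟫)⁻¹ • (x - ⟪x, p⟫ • p)

/-- On the unit sphere, stereographic projection from `p` is the inversion centred at `p` of
radius `√2`. -/
lemma sterProjFrom_eq_inversion {p x : EuclideanSpace ℝ (Fin 4)} (hp : ‖p‖ = 1) (hx : ‖x‖ = 1)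
    (hxp : x ≠ p) : sterProjFrom p x = EuclideanGeometry.inversion p (√2) x := by
  have hinner : inner ℝ x p ≠ 1 := fun h => hxp ((inner_eq_one_iff_of_norm_eq_one hx hp).mp h)
  have hne : 1 - inner ℝ x p ≠ 0 := sub_ne_zero.mpr hinner.symm
  have hdist : dist x p ^ 2 = 2 * (1 - inner ℝ x p) := by
    rw [dist_eq_norm, norm_sub_sq_real, hx, hp]
    ring
  have hscale : (√2 / dist x p) ^ 2 = (1 - inner ℝ x p)⁻¹ := by
    rw [div_pow, hdist, Real.sq_sqrt zero_le_two]
    field_simp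
  rw [sterProjFrom, EuclideanGeometry.inversion, hscale, vsub_eq_sub, vadd_eq_add]
  match_scalars
  · rfl
  · field_simp
    ring

/-- Inversion stretches the velocity of a curve by the factor `(R / dist (γ s) c) ^ 2`. -/
lemma norm_deriv_inversion_comp {F : Type*} [NormedAddCommGroup F] [InnerProductSpace ℝ F]
    {γ : ℝ → F} {c : F} {s : ℝ} (R : ℝ) (hγ : DifferentiableAt ℝ γ s) (hc : γ s ≠ c) :
    ‖deriv (fun u => EuclideanGeometry.inversion c R (γ u)) s‖ =
      (R / dist (γ s) c) ^ 2 * ‖deriv γ s‖ := by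
  have h : HasDerivAt (fun u => EuclideanGeometry.inversion c R (γ u)) _ s :=
    (EuclideanGeometry.hasFDerivAt_inversion hc).comp_hasDerivAt s hγ.hasDerivAt
  rw [h.deriv]
  simp [norm_smul, div_pow]

/-- The Möbius cross energy is invariant under stereographic projection of `S³` from any
pole `p` not lying on the link, both energies being computed with the ambient Euclidean
distance. -/
theorem mobiusEnergy_sterProj_invariant (γ₁ γ₂ : ℝ → EuclideanSpace ℝ (Fin 4))
    (p : EuclideanSpace ℝ (Fin 4)) (hp : ‖p‖ = 1)
    (h₁ : ContDiff ℝ 1 γ₁) (h₂ : ContDiff ℝ 1 γ₂)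
    (hper₁ : Function.Periodic γ₁ (2 * π)) (hper₂ : Function.Periodic γ₂ (2 * π))
    (hS₁ : ∀ s, ‖γ₁ s‖ = 1) (hS₂ : ∀ t, ‖γ₂ t‖ = 1)
    (hdisj : ∀ s t, γ₁ s ≠ γ₂ t)
    (hp₁ : ∀ s, γ₁ s ≠ p) (hp₂ : ∀ t, γ₂ t ≠ p) :
    mobiusEnergy (fun s => sterProjFrom p (γ₁ s)) (fun t => sterProjFrom p (γ₂ t)) =
      mobiusEnergy γ₁ γ₂ := by
  have e₁ : (fun s => sterProjFrom p (γ₁ s)) =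
      fun s => EuclideanGeometry.inversion p (√2) (γ₁ s) :=
    funext fun s => sterProjFrom_eq_inversion hp (hS₁ s) (hp₁ s)
  have e₂ : (fun t => sterProjFrom p (γ₂ t)) =
      fun t => EuclideanGeometry.inversion p (√2) (γ₂ t) :=
    funext fun t => sterProjFrom_eq_inversion hp (hS₂ t) (hp₂ t)
  rw [e₁, e₂]
  unfold mobiusEnergy
  congr! 4 with s t
  rw [norm_deriv_inversion_comp _ (h₁.differentiable one_ne_zero s) (hp₁ s),
    norm_deriv_inversion_comp _ (h₂.differentiable one_ne_zero t) (hp₂ t),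
    ← dist_eq_norm, ← dist_eq_norm, EuclideanGeometry.dist_inversion_inversion (hp₁ s) (hp₂ t)]
  have := dist_ne_zero.mpr (hp₁ s)
  have := dist_ne_zero.mpr (hp₂ t)
  have := dist_ne_zero.mpr (hdisj s t)
  field_simp

end
end

section
/- The area of the Gauss map of a link is bounded by its Möbius cross energy: if γ₁, γ₂ : ℝ → ℝ⁴ are C¹, 2π-periodic, with disjoint images, then ∫₀^{2π}∫₀^{2π} √( ‖∂ₛG(s,t)‖² ‖∂ₜG(s,t)‖² − ⟨∂ₛG(s,t), ∂ₜG(s,t)⟩² ) ds dt ≤ E(γ₁,γ₂), where G(s,t) = (γ₁(s) − γ₂(t))/‖γ₁(s) − γ₂(t)‖. -/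
open Real MeasureTheory

noncomputable section

/-- The Gauss map of a pair of disjoint curves in `ℝ⁴`, with values in `S³`. -/
def gaussMap (γ₁ γ₂ : ℝ → EuclideanSpace ℝ (Fin 4)) (s t : ℝ) : EuclideanSpace ℝ (Fin 4) :=
  ‖γ₁ s - γ₂ t‖⁻¹ • (γ₁ s - γ₂ t)

open RealInnerProductSpace in
/-- The `2`-dimensional Jacobian of the Gauss map. -/
def gaussJac (γ₁ γ₂ : ℝ → EuclideanSpace ℝ (Fin 4)) (s t : ℝ) : ℝ :=
  Real.sqrt (‖deriv (fun s' => gaussMap γ₁ γ₂ s' t) s‖ ^ 2 *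
      ‖deriv (fun t' => gaussMap γ₁ γ₂ s t') t‖ ^ 2 -
    ⟪deriv (fun s' => gaussMap γ₁ γ₂ s' t) s, deriv (fun t' => gaussMap γ₁ γ₂ s t') t⟫ ^ 2)

/-- Radial projection to the unit sphere shrinks velocities by at least the distance to the
origin. -/
theorem norm_deriv_inv_norm_smul_le {E : Type*} [NormedAddCommGroup E] [InnerProductSpace ℝ E]
    {f : ℝ → E} {f' : E} {x : ℝ} (hf : HasDerivAt f f' x) (hx : f x ≠ 0) :
    ‖deriv (fun y => ‖f y‖⁻¹ • f y) x‖ ≤ ‖f'‖ / ‖f x‖ := by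
  have hr : 0 < ‖f x‖ := norm_pos_iff.mpr hx
  have hnorm : HasDerivAt (fun y => ‖f y‖) (inner ℝ (f x) f' / ‖f x‖) x := by
    have h := hf.norm_sq.sqrt (by positivity)
    simp only [Real.sqrt_sq (norm_nonneg _)] at h
    convert h using 1
    field_simp
  have hG := (hnorm.inv hr.ne').smul hf
  have hderiv : deriv (fun y => ‖f y‖⁻¹ • f y) x = _ := hG.deriv
  rw [hderiv]
  refine (sq_le_sq₀ (norm_nonneg _) (by positivity)).mp ?_
  rw [norm_add_sq_real]
  simp only [norm_smul, real_inner_smul_left, real_inner_smul_right, mul_pow, norm_inv,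
    Real.norm_eq_abs, sq_abs, abs_norm, Pi.inv_apply, real_inner_comm (f x) f']
  have : (‖f'‖ / ‖f x‖) ^ 2 - (inner ℝ (f x) f' / ‖f x‖ ^ 2) ^ 2 ≤ (‖f'‖ / ‖f x‖) ^ 2 :=
    sub_le_self _ (sq_nonneg _)
  refine le_trans (le_of_eq ?_) this
  field_simp
  ring

theorem gaussJac_nonneg (γ₁ γ₂ : ℝ → EuclideanSpace ℝ (Fin 4)) (s t : ℝ) :
    0 ≤ gaussJac γ₁ γ₂ s t :=
  Real.sqrt_nonneg _

/-- The Jacobian of the Gauss map is at most the integrand of the Möbius cross energy. -/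
theorem gaussJac_le {γ₁ γ₂ : ℝ → EuclideanSpace ℝ (Fin 4)} {s t : ℝ}
    (h₁ : DifferentiableAt ℝ γ₁ s) (h₂ : DifferentiableAt ℝ γ₂ t) (hne : γ₁ s ≠ γ₂ t) :
    gaussJac γ₁ γ₂ s t ≤ ‖deriv γ₁ s‖ * ‖deriv γ₂ t‖ / ‖γ₁ s - γ₂ t‖ ^ 2 := by
  have hs : ‖deriv (fun s' => gaussMap γ₁ γ₂ s' t) s‖ ≤ ‖deriv γ₁ s‖ / ‖γ₁ s - γ₂ t‖ :=
    norm_deriv_inv_norm_smul_le (h₁.hasDerivAt.sub_const (γ₂ t)) (sub_ne_zero.mpr hne)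
  have ht : ‖deriv (fun t' => gaussMap γ₁ γ₂ s t') t‖ ≤ ‖deriv γ₂ t‖ / ‖γ₁ s - γ₂ t‖ := by
    have h := norm_deriv_inv_norm_smul_le (h₂.hasDerivAt.const_sub (γ₁ s)) (sub_ne_zero.mpr hne)
    rwa [norm_neg] at h
  calc gaussJac γ₁ γ₂ s t
      ≤ ‖deriv (fun s' => gaussMap γ₁ γ₂ s' t) s‖ * ‖deriv (fun t' => gaussMap γ₁ γ₂ s t') t‖ := by
        refine Real.sqrt_le_iff.mpr ⟨by positivity, ?_⟩
        rw [mul_pow]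
        exact sub_le_self _ (sq_nonneg _)
    _ ≤ (‖deriv γ₁ s‖ / ‖γ₁ s - γ₂ t‖) * (‖deriv γ₂ t‖ / ‖γ₁ s - γ₂ t‖) := by gcongr
    _ = ‖deriv γ₁ s‖ * ‖deriv γ₂ t‖ / ‖γ₁ s - γ₂ t‖ ^ 2 := by rw [div_mul_div_comm, ← sq]

/-- The integrand of the Möbius cross energy of two disjoint `C¹` curves is continuous. -/
theorem continuous_mobiusEnergy_integrand {E : Type*} [NormedAddCommGroup E] [NormedSpace ℝ E]
    {γ₁ γ₂ : ℝ → E} (h₁ : ContDiff ℝ 1 γ₁) (h₂ : ContDiff ℝ 1 γ₂)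
    (hdisj : ∀ s t, γ₁ s ≠ γ₂ t) :
    Continuous (Function.uncurry fun s t : ℝ =>
      ‖deriv γ₁ s‖ * ‖deriv γ₂ t‖ / ‖γ₁ s - γ₂ t‖ ^ 2) := by
  have hd₁ : Continuous (deriv γ₁) := h₁.continuous_deriv le_rfl
  have hd₂ : Continuous (deriv γ₂) := h₂.continuous_deriv le_rfl
  have hc₁ := h₁.continuous
  have hc₂ := h₂.continuous
  have hnum : Continuous fun p : ℝ × ℝ => ‖deriv γ₁ p.1‖ * ‖deriv γ₂ p.2‖ :=
    (hd₁.comp continuous_fst).norm.mul (hd₂.comp continuous_snd).norm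
  have hden : Continuous fun p : ℝ × ℝ => ‖γ₁ p.1 - γ₂ p.2‖ ^ 2 :=
    ((hc₁.comp continuous_fst).sub (hc₂.comp continuous_snd)).norm.pow 2
  exact hnum.div hden fun p =>
    pow_ne_zero 2 (norm_ne_zero_iff.mpr (sub_ne_zero.mpr (hdisj p.1 p.2)))

/-- Monotonicity of the interval integral when only the larger function is known to be
continuous, the smaller one being nonnegative. -/
theorem intervalIntegral_le_of_nonneg_of_le {f g : ℝ → ℝ} {a b : ℝ} (hab : a ≤ b)
    (hf : ∀ x, 0 ≤ f x) (hg : Continuous g) (hfg : ∀ x, f x ≤ g x) :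
    ∫ x in a..b, f x ≤ ∫ x in a..b, g x := by
  rw [intervalIntegral.integral_of_le hab, intervalIntegral.integral_of_le hab]
  exact integral_mono_of_nonneg (.of_forall hf)
    ((intervalIntegrable_iff_integrableOn_Ioc_of_le hab).mp (hg.intervalIntegrable a b))
    (.of_forall hfg)

/-- The area (with multiplicity) of the Gauss map of a link in `ℝ⁴` is bounded above by
its Möbius cross energy. -/
theorem gaussMap_area_le_mobiusEnergy (γ₁ γ₂ : ℝ → EuclideanSpace ℝ (Fin 4))
    (h₁ : ContDiff ℝ 1 γ₁) (h₂ : ContDiff ℝ 1 γ₂)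
    (hper₁ : Function.Periodic γ₁ (2 * π)) (hper₂ : Function.Periodic γ₂ (2 * π))
    (hdisj : ∀ s t, γ₁ s ≠ γ₂ t) :
    (∫ s in (0 : ℝ)..(2 * π), ∫ t in (0 : ℝ)..(2 * π), gaussJac γ₁ γ₂ s t) ≤
      mobiusEnergy γ₁ γ₂ := by
  have hpi : (0 : ℝ) ≤ 2 * π := by positivity
  have hcont := continuous_mobiusEnergy_integrand h₁ h₂ hdisj
  have hinner (s : ℝ) : (∫ t in (0 : ℝ)..(2 * π), gaussJac γ₁ γ₂ s t) ≤
      ∫ t in (0 : ℝ)..(2 * π), ‖deriv γ₁ s‖ * ‖deriv γ₂ t‖ / ‖γ₁ s - γ₂ t‖ ^ 2 := by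
    refine intervalIntegral_le_of_nonneg_of_le hpi (gaussJac_nonneg γ₁ γ₂ s) ?_ fun t => ?_
    · exact hcont.uncurry_left s
    · exact gaussJac_le (h₁.differentiable one_ne_zero s) (h₂.differentiable one_ne_zero t)
        (hdisj s t)
  have houter : Continuous fun s : ℝ =>
      ∫ t in (0 : ℝ)..(2 * π), ‖deriv γ₁ s‖ * ‖deriv γ₂ t‖ / ‖γ₁ s - γ₂ t‖ ^ 2 :=
    intervalIntegral.continuous_parametric_intervalIntegral_of_continuous' hcont _ _
  have hnonneg (s : ℝ) : 0 ≤ ∫ t in (0 : ℝ)..(2 * π), gaussJac γ₁ γ₂ s t :=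
    intervalIntegral.integral_nonneg hpi fun t _ => gaussJac_nonneg γ₁ γ₂ s t
  exact intervalIntegral_le_of_nonneg_of_le hpi hnonneg houter hinner

end
end
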